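/- Let Z be a PMM satisfying assumptions A1 and A2, and suppose Z is positive Harris. Then there exists a constant α ∈ (0,1) such that for every s ≥ 1 there exists a σ(X_{s:∞})-measurable random variable C_s < ∞ such that for all t ≥ s ≥ l ≥ 1, almost surely sup_{n ≥ t} sup_{m ≥ 1} ‖ν^t_{l:n;m} − ν^t_{s:n;m}‖_TV ≤ C_s α^{t−s}. -/

import Mathlib

open MeasureTheory ProbabilityTheory ENNReal

namespace PMMPaper

/-! ### General Markov chain notions (general state space) -/

section Kernels

variable {S : Type*} [MeasurableSpace S]

open Classical in
/-- `kpow κ k` is the `k`-step transition kernel of a Markov chain with one-step kernel `κ`. -/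
noncomputable def kpow (κ : Kernel S S) : ℕ → Kernel S S
  | 0 => Kernel.id
  | n + 1 => kpow κ n ∘ₖ κ

/-- `φ` is an irreducibility measure for the chain with kernel `κ`:
`φ(A) > 0` implies that from every point `z` some `k`-step transition reaches `A`
with positive probability. -/
def IsIrreducibilityMeasure (κ : Kernel S S) (φ : Measure S) : Prop :=
  ∀ A : Set S, MeasurableSet A → 0 < φ A → ∀ z : S, ∃ k : ℕ, 1 ≤ k ∧ 0 < kpow κ k z A

/-- `ψ` is a maximal irreducibility measure: a σ-finite irreducibility measure dominating
every other σ-finite irreducibility measure. -/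
def IsMaxIrreducibilityMeasure (κ : Kernel S S) (ψ : Measure S) : Prop :=
  SigmaFinite ψ ∧ IsIrreducibilityMeasure κ ψ ∧
    ∀ φ : Measure S, SigmaFinite φ → IsIrreducibilityMeasure κ φ → φ ≪ ψ

/-- `Pz` is the family of laws (on the path space `ℕ → S`) of the Markov chain with
transition kernel `κ` started at the point `z`:  `Pz z` is a probability measure under which
the coordinate process starts at `z` and is Markov with kernel `κ`. -/
def IsMarkovFamily (κ : Kernel S S) (Pz : S → Measure (ℕ → S)) : Prop :=
  (∀ z : S, IsProbabilityMeasure (Pz z)) ∧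
  (∀ z : S, Pz z {ω | ω 0 = z} = 1) ∧
  ∀ (z : S) (n : ℕ) (g : S → ℝ≥0∞), Measurable g → ∀ C : Set (ℕ → S),
    MeasurableSet[⨆ i ∈ Set.Iic n, MeasurableSpace.comap (fun ω : ℕ → S => ω i) inferInstance] C →
    ∫⁻ ω in C, g (ω (n + 1)) ∂(Pz z) = ∫⁻ ω in C, ∫⁻ z', g z' ∂(κ (ω n)) ∂(Pz z)

/-- Harris recurrence property (relative to the measure `ψ`): every set charged by `ψ` is
visited infinitely often, almost surely, from every starting point. -/
def HarrisProp (κ : Kernel S S) (Pz : S → Measure (ℕ → S)) (ψ : Measure S) : Prop :=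
  ∀ A : Set S, MeasurableSet A → 0 < ψ A → ∀ z : S,
    Pz z {ω | ∀ N : ℕ, ∃ k : ℕ, N ≤ k ∧ ω k ∈ A} = 1

/-- `π` is an invariant measure for the kernel `κ`. -/
def IsInvariantMeasure (κ : Kernel S S) (π : Measure S) : Prop :=
  π.bind (fun z => κ z) = π

/-- The chain is positive: its transition kernel admits an invariant probability measure. -/
def IsPositive (κ : Kernel S S) : Prop :=
  ∃ π : Measure S, IsProbabilityMeasure π ∧ IsInvariantMeasure κ π

/-- The process `Z` on `(Ω, P)` is a homogeneous Markov chain with transition kernel `κ`. -/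
def IsMarkovChain {Ω : Type*} [MeasurableSpace Ω] (P : Measure Ω) (Z : ℕ → Ω → S)
    (κ : Kernel S S) : Prop :=
  (∀ k : ℕ, Measurable (Z k)) ∧
  ∀ (n : ℕ) (g : S → ℝ≥0∞), Measurable g → ∀ C : Set Ω,
    MeasurableSet[⨆ i ∈ Set.Iic n, MeasurableSpace.comap (Z i) inferInstance] C →
    ∫⁻ ω in C, g (Z (n + 1) ω) ∂P = ∫⁻ ω in C, ∫⁻ z', g z' ∂(κ (Z n ω)) ∂P

/-- The process `Z : ℤ → Ω → S` on `(Ω, P)` is a (two-sided) homogeneous Markov chain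
with transition kernel `κ`. -/
def IsMarkovChainZ {Ω : Type*} [MeasurableSpace Ω] (P : Measure Ω) (Z : ℤ → Ω → S)
    (κ : Kernel S S) : Prop :=
  (∀ k : ℤ, Measurable (Z k)) ∧
  ∀ (n : ℤ) (g : S → ℝ≥0∞), Measurable g → ∀ C : Set Ω,
    MeasurableSet[⨆ i ∈ Set.Iic n, MeasurableSpace.comap (Z i) inferInstance] C →
    ∫⁻ ω in C, g (Z (n + 1) ω) ∂P = ∫⁻ ω in C, ∫⁻ z', g z' ∂(κ (Z n ω)) ∂P

/-- The reversed-time process of the two-sided chain `Z` is a Markov chain with kernel `κ'`. -/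
def IsRevMarkovChainZ {Ω : Type*} [MeasurableSpace Ω] (P : Measure Ω) (Z : ℤ → Ω → S)
    (κ' : Kernel S S) : Prop :=
  ∀ (n : ℤ) (g : S → ℝ≥0∞), Measurable g → ∀ C : Set Ω,
    MeasurableSet[⨆ i ∈ Set.Ici n, MeasurableSpace.comap (Z i) inferInstance] C →
    ∫⁻ ω in C, g (Z (n - 1) ω) ∂P = ∫⁻ ω in C, ∫⁻ z', g z' ∂(κ' (Z n ω)) ∂P

/-- The two-sided process `Z` is stationary: all finite-dimensional distributions are
invariant under time shifts. -/
def IsStationaryZ {Ω : Type*} [MeasurableSpace Ω] (P : Measure Ω) (Z : ℤ → Ω → S) : Prop :=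
  ∀ (k : ℤ) (n : ℕ),
    P.map (fun ω => fun i : Fin n => Z (k + (i : ℕ)) ω) =
      P.map (fun ω => fun i : Fin n => Z ((i : ℕ) : ℤ) ω)

/-- First-coordinate projection `A_(1)` of a set of finite strings. -/
def proj1 {α : Type*} {R : ℕ} (A : Set (Fin (R + 1) → α)) : Set α :=
  (fun x => x 0) '' A

/-- The section `A(a) = {x_{2:r} : (a, x_{2:r}) ∈ A}`. -/
def secSet {α : Type*} {R : ℕ} (A : Set (Fin (R + 1) → α)) (a : α) : Set (Fin R → α) :=
  {xr | Fin.cons a xr ∈ A}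

end Kernels

/-! ### Pairwise Markov models -/

variable {𝓧 : Type*} [MeasurableSpace 𝓧] {𝓨 : Type*} [Fintype 𝓨] [DecidableEq 𝓨]
  [MeasurableSpace 𝓨] [MeasurableSingletonClass 𝓨] [Nonempty 𝓨]
  {Ω : Type*} [MeasurableSpace Ω]

/-- `Z` is a pairwise Markov model on `(Ω, P)`: a homogeneous Markov chain on `𝓧 × 𝓨`
whose transition kernel `κ` has density `q(z'|z)` with respect to `μ × count`, and whose
initial distribution has density `p0` with respect to `μ × count`. -/
def IsPMM (P : Measure Ω) (Z : ℕ → Ω → 𝓧 × 𝓨) (κ : Kernel (𝓧 × 𝓨) (𝓧 × 𝓨))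
    (μ : Measure 𝓧) (q : 𝓧 × 𝓨 → 𝓧 × 𝓨 → ℝ≥0∞) (p0 : 𝓧 × 𝓨 → ℝ≥0∞) : Prop :=
  IsProbabilityMeasure P ∧ IsMarkovChain P Z κ ∧ SigmaFinite μ ∧
  Measurable (Function.uncurry q) ∧ Measurable p0 ∧
  (∀ z : 𝓧 × 𝓨, (κ z : Measure (𝓧 × 𝓨)) =
      (μ.prod Measure.count).withDensity (fun z' => q z' z)) ∧
  P.map (Z 0) = (μ.prod Measure.count).withDensity p0

/-- Two-sided version of `IsPMM`. -/
def IsPMMZ (P : Measure Ω) (Z : ℤ → Ω → 𝓧 × 𝓨) (κ : Kernel (𝓧 × 𝓨) (𝓧 × 𝓨))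
    (μ : Measure 𝓧) (q : 𝓧 × 𝓨 → 𝓧 × 𝓨 → ℝ≥0∞) (p0 : 𝓧 × 𝓨 → ℝ≥0∞) : Prop :=
  IsProbabilityMeasure P ∧ IsMarkovChainZ P Z κ ∧ SigmaFinite μ ∧
  Measurable (Function.uncurry q) ∧ Measurable p0 ∧
  (∀ z : 𝓧 × 𝓨, (κ z : Measure (𝓧 × 𝓨)) =
      (μ.prod Measure.count).withDensity (fun z' => q z' z)) ∧
  P.map (Z 0) = (μ.prod Measure.count).withDensity p0

/-- `pijD q x i j` is the conditional density
`p_{ij}(x_{1:r}) = p(x_{2:r}, y_r = j | x_1, y_1 = i)` (a string `x` of length `R+1`). -/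
noncomputable def pijD (q : 𝓧 × 𝓨 → 𝓧 × 𝓨 → ℝ≥0∞) {R : ℕ} (x : Fin (R + 1) → 𝓧)
    (i j : 𝓨) : ℝ≥0∞ :=
  ∑ y : Fin (R + 1) → 𝓨,
    (if y 0 = i ∧ y (Fin.last R) = j then
      ∏ k : Fin R, q (x k.succ, y k.succ) (x k.castSucc, y k.castSucc) else 0)

/-- `pmidD q x i t j` is the density `p(y_{t+1} = j, x_{2:r} | x_1, y_1 = i)`. -/
noncomputable def pmidD (q : 𝓧 × 𝓨 → 𝓧 × 𝓨 → ℝ≥0∞) {R : ℕ} (x : Fin (R + 1) → 𝓧)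
    (i : 𝓨) (t : Fin (R + 1)) (j : 𝓨) : ℝ≥0∞ :=
  ∑ y : Fin (R + 1) → 𝓨,
    (if y 0 = i ∧ y t = j then
      ∏ k : Fin R, q (x k.succ, y k.succ) (x k.castSucc, y k.castSucc) else 0)

/-- `pxD q x i = p(x_{2:r} | x_1, y_1 = i)`. -/
noncomputable def pxD (q : 𝓧 × 𝓨 → 𝓧 × 𝓨 → ℝ≥0∞) {R : ℕ} (x : Fin (R + 1) → 𝓧)
    (i : 𝓨) : ℝ≥0∞ :=
  ∑ j : 𝓨, pijD q x i j

/-- The set `Y⁺(x_{1:r}) = {(i,j) : p_{ij}(x_{1:r}) > 0}`. -/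
def Yplus (q : 𝓧 × 𝓨 → 𝓧 × 𝓨 → ℝ≥0∞) {R : ℕ} (x : Fin (R + 1) → 𝓧) : Set (𝓨 × 𝓨) :=
  {p : 𝓨 × 𝓨 | 0 < pijD q x p.1 p.2}

/-- Joint density `p(x_{1:r}, y_{1:r})` of `Z_{1:r}`, built from the initial density `p0`
and the transition density `q`. -/
noncomputable def jointD (p0 : 𝓧 × 𝓨 → ℝ≥0∞) (q : 𝓧 × 𝓨 → 𝓧 × 𝓨 → ℝ≥0∞) {R : ℕ}
    (x : Fin (R + 1) → 𝓧) (y : Fin (R + 1) → 𝓨) : ℝ≥0∞ :=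
  p0 (x 0, y 0) * ∏ k : Fin R, q (x k.succ, y k.succ) (x k.castSucc, y k.castSucc)

/-- Density `p(x_{1:r})` of the observations `X_{1:r}`. -/
noncomputable def pXD (p0 : 𝓧 × 𝓨 → ℝ≥0∞) (q : 𝓧 × 𝓨 → 𝓧 × 𝓨 → ℝ≥0∞) {R : ℕ}
    (x : Fin (R + 1) → 𝓧) : ℝ≥0∞ :=
  ∑ y : Fin (R + 1) → 𝓨, jointD p0 q x y

/-- The set `Y*(x_{1:r}) = {(y_1, y_r) : ∃ y_{2:r-1}, p(x_{1:r}, y_{1:r}) > 0}`. -/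
def Ystar (p0 : 𝓧 × 𝓨 → ℝ≥0∞) (q : 𝓧 × 𝓨 → 𝓧 × 𝓨 → ℝ≥0∞) {R : ℕ}
    (x : Fin (R + 1) → 𝓧) : Set (𝓨 × 𝓨) :=
  {p : 𝓨 × 𝓨 | ∃ y : Fin (R + 1) → 𝓨,
    y 0 = p.1 ∧ y (Fin.last R) = p.2 ∧ 0 < jointD p0 q x y}

/-- Assumption **A1**: there is `r = R + 1 > 1` and a set `E ⊆ 𝓧^r` on which
`Y⁺(x_{1:r}) = Y⁺` is constant, nonempty, and a product set. -/
def Assumption1 (q : 𝓧 × 𝓨 → 𝓧 × 𝓨 → ℝ≥0∞) {R : ℕ} (E : Set (Fin (R + 1) → 𝓧))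
    (Yp : Set (𝓨 × 𝓨)) : Prop :=
  1 ≤ R ∧ Yp.Nonempty ∧ (∀ x ∈ E, Yplus q x = Yp) ∧
    Yp = (Prod.fst '' Yp) ×ˢ (Prod.snd '' Yp)

/-- Assumption **A2**: `ψ` is a maximal irreducibility measure for the chain,
`ψ(E_(1) × Y⁺_(1)) > 0` and `μ^{r-1}(E(x₁)) > 0` for all `x₁ ∈ E_(1)`. -/
def Assumption2 (κ : Kernel (𝓧 × 𝓨) (𝓧 × 𝓨)) (ψ : Measure (𝓧 × 𝓨)) (μ : Measure 𝓧)
    {R : ℕ} (E : Set (Fin (R + 1) → 𝓧)) (Yp : Set (𝓨 × 𝓨)) : Prop :=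
  IsMaxIrreducibilityMeasure κ ψ ∧
  0 < ψ (proj1 E ×ˢ (Prod.fst '' Yp)) ∧
  ∀ x₁ ∈ proj1 E, 0 < (Measure.pi fun _ : Fin R => μ) (secSet E x₁)

/-- Assumption **A1'** (stationary case): `Y*(x_{1:r}) = Y*` is constant on `E`,
nonempty and a product set. -/
def Assumption1' (p0 : 𝓧 × 𝓨 → ℝ≥0∞) (q : 𝓧 × 𝓨 → 𝓧 × 𝓨 → ℝ≥0∞) {R : ℕ}
    (E : Set (Fin (R + 1) → 𝓧)) (Ys : Set (𝓨 × 𝓨)) : Prop :=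
  1 ≤ R ∧ Ys.Nonempty ∧ (∀ x ∈ E, Ystar p0 q x = Ys) ∧
    Ys = (Prod.fst '' Ys) ×ˢ (Prod.snd '' Ys)

/-- Assumption **A2'**: `μ^r(E) > 0`. -/
def Assumption2' (μ : Measure 𝓧) {R : ℕ} (E : Set (Fin (R + 1) → 𝓧)) : Prop :=
  0 < (Measure.pi fun _ : Fin (R + 1) => μ) E

/-! ### Smoothing distributions -/

/-- The σ-algebra `σ(X_{l:n})` generated by the observations with indices in `[l, n]`. -/
noncomputable def obsSigma (Z : ℕ → Ω → 𝓧 × 𝓨) (l n : ℕ) : MeasurableSpace Ω :=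
  ⨆ i ∈ Set.Icc l n, MeasurableSpace.comap (fun ω => (Z i ω).1) inferInstance

/-- The σ-algebra `σ(X_{s:∞})` generated by the observations with indices `≥ s`. -/
noncomputable def obsSigmaFrom (Z : ℕ → Ω → 𝓧 × 𝓨) (s : ℕ) : MeasurableSpace Ω :=
  ⨆ i ∈ Set.Ici s, MeasurableSpace.comap (fun ω => (Z i ω).1) inferInstance

/-- The smoothing probability `ν^t_{l:n;m}(v) = P(Y_{t:t+m-1} = v | X_{l:n})`,
realized as a conditional expectation of an indicator. -/
noncomputable def smooth (P : Measure Ω) (Z : ℕ → Ω → 𝓧 × 𝓨) (t l n : ℕ) {m : ℕ}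
    (v : Fin m → 𝓨) : Ω → ℝ :=
  P[Set.indicator {ω | ∀ i : Fin m, (Z (t + (i : ℕ)) ω).2 = v i} (fun _ => (1 : ℝ)) |
    obsSigma Z l n]

/-- Total variation distance `‖ν^t_{l:n;m} − ν^t_{s:n;m}‖_TV`. -/
noncomputable def tvBlock (P : Measure Ω) (Z : ℕ → Ω → 𝓧 × 𝓨) (t l s n m : ℕ) (ω : Ω) : ℝ :=
  ∑ v : Fin m → 𝓨, |smooth P Z t l n v ω - smooth P Z t s n v ω|

/-- Two-sided version: the σ-algebra `σ(X_i ; i ∈ I)` for `I ⊆ ℤ`. -/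
noncomputable def obsSigmaZ (Z : ℤ → Ω → 𝓧 × 𝓨) (I : Set ℤ) : MeasurableSpace Ω :=
  ⨆ i ∈ I, MeasurableSpace.comap (fun ω => (Z i ω).1) inferInstance

/-- Two-sided smoothing probability `P(Y_{t:t+m-1} = v | X_i ; i ∈ I)`. -/
noncomputable def smoothZ (P : Measure Ω) (Z : ℤ → Ω → 𝓧 × 𝓨) (t : ℤ) (I : Set ℤ) {m : ℕ}
    (v : Fin m → 𝓨) : Ω → ℝ :=
  P[Set.indicator {ω | ∀ i : Fin m, (Z (t + (i : ℕ)) ω).2 = v i} (fun _ => (1 : ℝ)) |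
    obsSigmaZ Z I]

/-- Two-sided total variation distance between smoothing distributions with observation
index sets `I` and `J`. -/
noncomputable def tvBlockZ (P : Measure Ω) (Z : ℤ → Ω → 𝓧 × 𝓨) (t : ℤ) (I J : Set ℤ)
    (m : ℕ) (ω : Ω) : ℝ :=
  ∑ v : Fin m → 𝓨, |smoothZ P Z t I v ω - smoothZ P Z t J v ω|

/-! ### Counters, Doeblin matrices -/

/-- `κ_k(X_{s:t})`: the number of (almost non-overlapping) `E`-blocks of length `R+1`
in the observed string, counting from position `s + k` (paper's `κ_k`, `r' = R`). -/
noncomputable def kapCount (Z : ℕ → Ω → 𝓧 × 𝓨) {R : ℕ} (E : Set (Fin (R + 1) → 𝓧))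
    (s t kk : ℕ) (ω : Ω) : ℕ :=
  ∑ u ∈ Finset.range ((t - kk - s) / R),
    Set.indicator E (fun _ => 1) (fun i : Fin (R + 1) => (Z (u * R + s + kk + (i : ℕ)) ω).1)

/-- `κ̄(X_{s:t})`: the backward counter, counting `E`-blocks from position `t` backwards. -/
noncomputable def kapBar (Z : ℕ → Ω → 𝓧 × 𝓨) {R : ℕ} (E : Set (Fin (R + 1) → 𝓧))
    (s t : ℕ) (ω : Ω) : ℕ :=
  ∑ u ∈ Finset.range ((t - s) / R),
    Set.indicator E (fun _ => 1) (fun i : Fin (R + 1) => (Z (t - (u + 1) * R + (i : ℕ)) ω).1)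

open Classical in
/-- The segment `x_{a+1:b+1}` (0-based indices `a..b`) of a string of length `L+1`. -/
def segv {L : ℕ} (x : Fin (L + 1) → 𝓧) (a b : ℕ) (hab : a ≤ b) (hb : b ≤ L) :
    Fin (b - a + 1) → 𝓧 :=
  fun i => x ⟨a + (i : ℕ), by omega⟩

/-- Normalizing constant `c(x_{r:n}) = ∑_{j ∈ Y₂} p(x_{r+1:n} | x_r, y_r = j)`. -/
noncomputable def normC (q : 𝓧 × 𝓨 → 𝓧 × 𝓨 → ℝ≥0∞) (Y2 : Set 𝓨) {M : ℕ}
    (w : Fin (M + 1) → 𝓧) : ℝ≥0∞ :=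
  ∑ j : 𝓨, Set.indicator Y2 (fun j' => pxD q w j') j

/-- The probability vector `λ[x_{r:n}](j)`. -/
noncomputable def lamD (q : 𝓧 × 𝓨 → 𝓧 × 𝓨 → ℝ≥0∞) (Y2 : Set 𝓨) {M : ℕ}
    (w : Fin (M + 1) → 𝓧) (j : 𝓨) : ℝ≥0∞ :=
  Set.indicator Y2 (fun j' => pxD q w j') j / normC q Y2 w

/-- The matrix `U[x_{1:n}](i,j)`; a version of `P(Y_r = j | X_{1:n} = x_{1:n}, Y_1 = i)`. -/
noncomputable def UMat (q : 𝓧 × 𝓨 → 𝓧 × 𝓨 → ℝ≥0∞) (Y2 : Set 𝓨) {L R : ℕ} (hR : R ≤ L)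
    (x : Fin (L + 1) → 𝓧) (i j : 𝓨) : ℝ≥0∞ :=
  if 0 < pxD q x i then pmidD q x i ⟨R, by omega⟩ j / pxD q x i
  else lamD q Y2 (segv x R L hR (le_refl L)) j

/-! ### Total variation of measures, conditional laws of `Y_{t:∞}` -/

open Classical in
/-- Total variation distance between two measures (normalized as in the paper:
`‖P − Q‖_TV = 2 sup_A |P(A) − Q(A)|`). -/
noncomputable def tvDistM {W : Type*} [MeasurableSpace W] (ρ₁ ρ₂ : Measure W) : ℝ≥0∞ :=
  2 * ⨆ (A : Set W) (_ : MeasurableSet A), ((ρ₁ A - ρ₂ A) ⊔ (ρ₂ A - ρ₁ A))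

/-- The observation vector `X_{l:n}`. -/
def obsVec (Z : ℕ → Ω → 𝓧 × 𝓨) (l n : ℕ) (ω : Ω) : Fin (n + 1 - l) → 𝓧 :=
  fun i => (Z (l + (i : ℕ)) ω).1

/-- The tail signal process `Y_{t:∞}`. -/
def tailY (Z : ℕ → Ω → 𝓧 × 𝓨) (t : ℕ) (ω : Ω) : ℕ → 𝓨 :=
  fun k => (Z (t + k) ω).2

/-- The observation tail `X_{l:∞}`. -/
def obsTail (Z : ℕ → Ω → 𝓧 × 𝓨) (l : ℕ) (ω : Ω) : ℕ → 𝓧 :=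
  fun k => (Z (l + k) ω).1

/-- A regular version of the conditional distribution `P(Y_{t:∞} ∈ · | X_{l:n})`,
evaluated at `ω`. -/
noncomputable def condLawTail (P : Measure Ω) [IsFiniteMeasure P] (Z : ℕ → Ω → 𝓧 × 𝓨)
    (t l n : ℕ) (ω : Ω) : Measure (ℕ → 𝓨) :=
  condDistrib (tailY Z t) (obsVec Z l n) P (obsVec Z l n ω)

/-- A regular version of the conditional distribution `P(Y_{t:∞} ∈ · | X_{l:∞})`,
evaluated at `ω`. -/
noncomputable def condLawTailInf (P : Measure Ω) [IsFiniteMeasure P] (Z : ℕ → Ω → 𝓧 × 𝓨)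
    (t l : ℕ) (ω : Ω) : Measure (ℕ → 𝓨) :=
  condDistrib (tailY Z t) (obsTail Z l) P (obsTail Z l ω)

/-! ### Hidden Markov models and matrices -/

/-- Powers of a nonnegative matrix on `𝓨`. -/
noncomputable def matpow (p : 𝓨 → 𝓨 → ℝ≥0∞) : ℕ → 𝓨 → 𝓨 → ℝ≥0∞
  | 0 => fun i j => if i = j then 1 else 0
  | n + 1 => fun i j => ∑ k : 𝓨, matpow p n i k * p k j

/-- The sub-matrix `ℙ_C` of `p` with rows and columns restricted to `C` (and `0` outside). -/
noncomputable def subMat (p : 𝓨 → 𝓨 → ℝ≥0∞) (C : Set 𝓨) : 𝓨 → 𝓨 → ℝ≥0∞ :=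
  fun i j => Set.indicator (C ×ˢ C) (fun ij : 𝓨 × 𝓨 => p ij.1 ij.2) (i, j)

/-- Support `G_i = {x : f_i(x) > 0}` of the emission density `f_i`. -/
def emisSupp (f : 𝓨 → 𝓧 → ℝ≥0∞) (i : 𝓨) : Set 𝓧 :=
  {x | 0 < f i x}

/-- `C` is a cluster: `μ[(∩_{i∈C} G_i) \ (∪_{i∉C} G_i)] > 0`. -/
def IsCluster (μ : Measure 𝓧) (f : 𝓨 → 𝓧 → ℝ≥0∞) (C : Set 𝓨) : Prop :=
  0 < μ ((⋂ i ∈ C, emisSupp f i) \ (⋃ i ∈ Cᶜ, emisSupp f i))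

section MC

variable {S : Type*} [MeasurableSpace S]

/-- iterated cylinder probability -/
noncomputable def Lc (κ : Kernel S S) : ℕ → (ℕ → Set S) → S → ℝ≥0∞
  | 0, _, _ => 1
  | M + 1, A, z => (A 0).indicator (fun _ => ∫⁻ z', Lc κ M (fun i => A (i + 1)) z' ∂(κ z)) z

theorem measurable_Lc (κ : Kernel S S) (M : ℕ) : ∀ (A : ℕ → Set S), (∀ i, MeasurableSet (A i)) →
    Measurable (Lc κ M A) := by
  induction M with
  | zero => intro A hA; exact measurable_const
  | succ M ih =>
    intro A hA
    have h1 := ih (fun i => A (i + 1)) (fun i => hA _)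
    have h2 : Measurable (fun z => ∫⁻ z', Lc κ M (fun i => A (i + 1)) z' ∂(κ z)) :=
      h1.lintegral_kernel
    exact h2.indicator (hA 0)

theorem Lc_le_one (κ : Kernel S S) [IsMarkovKernel κ] (M : ℕ) : ∀ (A : ℕ → Set S) (z : S),
    Lc κ M A z ≤ 1 := by
  induction M with
  | zero => intro A z; simp [Lc]
  | succ M ih =>
    intro A z
    rw [Lc]
    refine (Set.indicator_le_self _ _ _).trans ?_
    calc ∫⁻ z', Lc κ M (fun i => A (i + 1)) z' ∂(κ z) ≤ ∫⁻ z', 1 ∂(κ z) :=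
          lintegral_mono (fun z' => ih _ _)
      _ = 1 := by simp

theorem mc_cyl {P : Measure Ω} {Z : ℕ → Ω → S} {κ : Kernel S S} (h : IsMarkovChain P Z κ)
    (M : ℕ) : ∀ (k : ℕ) (A : ℕ → Set S), (∀ i, MeasurableSet (A i)) → ∀ C : Set Ω,
    MeasurableSet[⨆ i ∈ Set.Iic k, MeasurableSpace.comap (Z i) inferInstance] C →
    P (C ∩ {ω | ∀ i < M, Z (k + i) ω ∈ A i}) = ∫⁻ ω in C, Lc κ M A (Z k ω) ∂P := by
  induction M with
  | zero => intro k A hA C hC; simp [Lc]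
  | succ M ih =>
    intro k A hA C hC
    have hZk : MeasurableSet[⨆ i ∈ Set.Iic k, MeasurableSpace.comap (Z i) inferInstance]
        (Z k ⁻¹' (A 0)) := by
      have : MeasurableSpace.comap (Z k) inferInstance ≤
        ⨆ i ∈ Set.Iic k, MeasurableSpace.comap (Z i) inferInstance :=
        le_iSup₂_of_le k (Set.mem_Iic.2 le_rfl) le_rfl
      exact this _ ⟨A 0, hA 0, rfl⟩
    have hC' := hC.inter hZk
    have hmono : (⨆ i ∈ Set.Iic k, MeasurableSpace.comap (Z i) inferInstance) ≤
      (⨆ i ∈ Set.Iic (k + 1), MeasurableSpace.comap (Z i) (inferInstance : MeasurableSpace S)) :=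
      biSup_mono (fun i hi => Set.mem_Iic.2 ((Set.mem_Iic.1 hi).trans (Nat.le_succ k)))
    have e1 : C ∩ {ω | ∀ i < M + 1, Z (k + i) ω ∈ A i} =
        (C ∩ Z k ⁻¹' (A 0)) ∩ {ω | ∀ i < M, Z (k + 1 + i) ω ∈ A (i + 1)} := by
      ext ω
      simp only [Set.mem_inter_iff, Set.mem_ofPred_eq, Set.mem_preimage]
      constructor
      · rintro ⟨h1, h2⟩
        refine ⟨⟨h1, by simpa using h2 0 (Nat.succ_pos _)⟩, fun i hi => ?_⟩
        have := h2 (i + 1) (by omega)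
        rwa [show k + (i + 1) = k + 1 + i by ring] at this
      · rintro ⟨⟨h1, h2⟩, h3⟩
        refine ⟨h1, fun i hi => ?_⟩
        rcases i with _ | i
        · simpa using h2
        · rw [show k + (i + 1) = k + 1 + i by ring]; exact h3 i (by omega)
    rw [e1, ih (k + 1) (fun i => A (i + 1)) (fun i => hA _) _ (hmono _ hC'),
      h.2 k _ (measurable_Lc κ M _ (fun i => hA _)) _ hC', Set.inter_comm,
      ← Measure.restrict_restrict ((h.1 k) (hA 0)), ← lintegral_indicator ((h.1 k) (hA 0))]
    rfl

/-- `T` is the path kernel of the chain with kernel `κ`. -/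
def IsPathK (κ : Kernel S S) (T : Kernel S (ℕ → S)) : Prop :=
  ∀ (M : ℕ) (A : ℕ → Set S), (∀ i, MeasurableSet (A i)) → ∀ z : S,
    T z {η | ∀ i < M, η i ∈ A i} = Lc κ M A z

theorem path_cyl_form {B : Set (ℕ → S)}
    (hB : B ∈ squareCylinders (fun _ : ℕ => {s : Set S | MeasurableSet s})) :
    ∃ (M : ℕ) (A : ℕ → Set S), (∀ i, MeasurableSet (A i)) ∧ B = {η | ∀ i < M, η i ∈ A i} := by
  classical
  obtain ⟨s, t, ht, rfl⟩ := hB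
  refine ⟨s.sup id + 1, fun i => if i ∈ s then t i else Set.univ, fun i => ?_, ?_⟩
  · simp only
    split_ifs
    · exact ht i (Set.mem_univ _)
    · exact MeasurableSet.univ
  · ext η
    simp only [Set.mem_pi, Finset.mem_coe, Set.mem_ofPred_eq]
    constructor
    · intro h i _
      split_ifs with hi
      · exact h i hi
      · trivial
    · intro h i hi
      have := h i (Nat.lt_succ_of_le (Finset.le_sup (f := id) hi))
      simpa [hi] using this

theorem path_pi : IsPiSystem (squareCylinders (fun _ : ℕ => {s : Set S | MeasurableSet s})) :=
  isPiSystem_squareCylinders (fun _ => MeasurableSpace.isPiSystem_measurableSet)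
    (fun _ => MeasurableSet.univ)

theorem family_start [MeasurableSingletonClass S] {κ : Kernel S S} {Pz : S → Measure (ℕ → S)}
    (h : IsMarkovFamily κ Pz) (z : S) : ∀ᵐ η ∂(Pz z), η 0 = z := by
  have := h.1 z
  have hm : MeasurableSet {η : ℕ → S | η 0 = z} :=
    measurable_pi_apply (X := fun _ : ℕ => S) 0 (measurableSet_singleton z)
  exact (prob_compl_eq_zero_iff hm).2 (h.2.1 z)

theorem family_mc {κ : Kernel S S} {Pz : S → Measure (ℕ → S)}
    (h : IsMarkovFamily κ Pz) (z : S) :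
    IsMarkovChain (Pz z) (fun i (η : ℕ → S) => η i) κ :=
  ⟨fun k => measurable_pi_apply k, h.2.2 z⟩

theorem family_markov [MeasurableSingletonClass S] {κ : Kernel S S} {Pz : S → Measure (ℕ → S)}
    (h : IsMarkovFamily κ Pz) : IsMarkovKernel κ := by
  refine ⟨fun z => ⟨?_⟩⟩
  have := h.1 z
  have h1 := h.2.2 z 0 (fun _ => 1) measurable_const Set.univ MeasurableSet.univ
  simp only [lintegral_const, one_mul, Measure.restrict_univ, measure_univ] at h1
  rw [lintegral_congr_ae (g := fun _ => κ z Set.univ)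
    (by filter_upwards [family_start h z] with η hη; rw [hη])] at h1
  simpa using h1.symm

theorem family_cyl [MeasurableSingletonClass S] {κ : Kernel S S} {Pz : S → Measure (ℕ → S)}
    (h : IsMarkovFamily κ Pz) (M : ℕ) (A : ℕ → Set S) (hA : ∀ i, MeasurableSet (A i)) (z : S) :
    Pz z {η | ∀ i < M, η i ∈ A i} = Lc κ M A z := by
  have := h.1 z
  have h1 := mc_cyl (family_mc h z) M 0 A hA Set.univ MeasurableSet.univ
  simp only [Set.univ_inter, zero_add, Measure.restrict_univ] at h1
  rw [h1, lintegral_congr_ae (g := fun _ => Lc κ M A z)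
    (by filter_upwards [family_start h z] with η hη; rw [hη])]
  simp

/-- the path kernel built from the Markov family -/
theorem exists_pathK [MeasurableSingletonClass S] {κ : Kernel S S} {Pz : S → Measure (ℕ → S)}
    (h : IsMarkovFamily κ Pz) :
    ∃ T : Kernel S (ℕ → S), IsMarkovKernel T ∧ IsPathK κ T ∧ ∀ z, T z = Pz z := by
  have hp := h.1
  have hm : Measurable Pz := by
    refine Measurable.measure_of_isPiSystem_of_isProbabilityMeasure
      (generateFrom_squareCylinders (α := fun _ : ℕ => S)).symm path_pi ?_
    intro B hB
    obtain ⟨M, A, hA, rfl⟩ := path_cyl_form hB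
    simp_rw [family_cyl h M A hA]
    exact measurable_Lc κ M A hA
  refine ⟨⟨Pz, hm⟩, ⟨hp⟩, fun M A hA z => family_cyl h M A hA z, fun z => rfl⟩

/-- The Markov property, set version. -/
theorem mc_set {P : Measure Ω} [IsProbabilityMeasure P] {Z : ℕ → Ω → S} {κ : Kernel S S}
    (h : IsMarkovChain P Z κ) {T : Kernel S (ℕ → S)} [IsMarkovKernel T] (hT : IsPathK κ T) (k : ℕ)
    {C : Set Ω} (hC : MeasurableSet[⨆ i ∈ Set.Iic k, MeasurableSpace.comap (Z i) inferInstance] C)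
    {B : Set (ℕ → S)} (hB : MeasurableSet B) :
    P (C ∩ {ω | (fun i => Z (k + i) ω) ∈ B}) = ∫⁻ ω in C, T (Z k ω) B ∂P := by
  have hle : (⨆ i ∈ Set.Iic k, MeasurableSpace.comap (Z i) (inferInstance : MeasurableSpace S)) ≤
      (inferInstance : MeasurableSpace Ω) := iSup₂_le fun i _ => (h.1 i).comap_le
  have hC0 : MeasurableSet C := hle _ hC
  have hθ : Measurable (fun ω => (fun i => Z (k + i) ω)) :=
    measurable_pi_lambda _ (fun i => h.1 _)
  have key : (P.restrict C).map (fun ω => (fun i => Z (k + i) ω)) =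
      (P.restrict C).bind (T.comap (Z k) (h.1 k)) := by
    refine ext_of_generate_finite _ (generateFrom_squareCylinders (α := fun _ : ℕ => S)).symm
      path_pi ?_ ?_
    · intro B hB
      obtain ⟨M, A, hA, rfl⟩ := path_cyl_form hB
      have hm : MeasurableSet {η : ℕ → S | ∀ i < M, η i ∈ A i} := by
        rw [show {η : ℕ → S | ∀ i < M, η i ∈ A i} = ⋂ i, ⋂ (_ : i < M), {η | η i ∈ A i} by
          ext; simp]
        exact MeasurableSet.iInter fun i => MeasurableSet.iInter fun _ =>
          (measurable_pi_apply i) (hA i)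
      rw [Measure.map_apply hθ hm, Measure.restrict_apply (hθ hm),
        Measure.bind_apply hm (Kernel.aemeasurable _), Set.inter_comm]
      simp only [Kernel.comap_apply, hT M A hA]
      exact mc_cyl h M k A hA C hC
    · rw [Measure.map_apply hθ MeasurableSet.univ,
        Measure.bind_apply MeasurableSet.univ (Kernel.aemeasurable _)]
      simp
  have := congrArg (fun ν => ν B) key
  rw [Measure.map_apply hθ hB, Measure.restrict_apply (hθ hB),
        Measure.bind_apply hB (Kernel.aemeasurable _), Set.inter_comm] at this
  exact this

/-- The Markov property, joint functional version. -/
theorem mc_joint {P : Measure Ω} [IsProbabilityMeasure P] {Z : ℕ → Ω → S} {κ : Kernel S S}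
    (h : IsMarkovChain P Z κ) {T : Kernel S (ℕ → S)} [IsMarkovKernel T] (hT : IsPathK κ T) (k : ℕ)
    {𝓐 : Type*} [MeasurableSpace 𝓐] (U : Ω → 𝓐)
    (hU : Measurable[⨆ i ∈ Set.Iic k, MeasurableSpace.comap (Z i) inferInstance] U)
    (F : 𝓐 × (ℕ → S) → ℝ≥0∞) (hF : Measurable F) :
    ∫⁻ ω, F (U ω, fun i => Z (k + i) ω) ∂P = ∫⁻ ω, ∫⁻ η, F (U ω, η) ∂(T (Z k ω)) ∂P := by
  have hle : (⨆ i ∈ Set.Iic k, MeasurableSpace.comap (Z i) (inferInstance : MeasurableSpace S)) ≤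
      (inferInstance : MeasurableSpace Ω) := iSup₂_le fun i _ => (h.1 i).comap_le
  have hU0 : Measurable U := fun s hs => hle _ (hU hs)
  have hθ : Measurable (fun ω => (fun i => Z (k + i) ω)) :=
    measurable_pi_lambda _ (fun i => h.1 _)
  have hm1 : Measurable (fun p : Ω × (ℕ → S) => (U p.1, p.2)) :=
    (hU0.comp measurable_fst).prodMk measurable_snd
  have key : P.map (fun ω => (U ω, fun i => Z (k + i) ω)) =
      (P ⊗ₘ (T.comap (Z k) (h.1 k))).map (fun p => (U p.1, p.2)) := by
    have : IsProbabilityMeasure (P.map (fun ω => (U ω, fun i => Z (k + i) ω))) :=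
      Measure.isProbabilityMeasure_map (hU0.prodMk hθ).aemeasurable
    refine Measure.ext_prod ?_
    intro s t hs ht
    rw [Measure.map_apply (hU0.prodMk hθ) (hs.prod ht), Measure.map_apply hm1 (hs.prod ht)]
    have e1 : (fun ω => (U ω, fun i => Z (k + i) ω)) ⁻¹' s ×ˢ t =
      (U ⁻¹' s) ∩ {ω | (fun i => Z (k + i) ω) ∈ t} := by ext; simp
    have e2 : (fun p : Ω × (ℕ → S) => (U p.1, p.2)) ⁻¹' s ×ˢ t = (U ⁻¹' s) ×ˢ t := by ext; simp
    rw [e1, e2, mc_set h hT k (hU hs) ht, Measure.compProd_apply_prod (hU0 hs) ht]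
    rfl
  have h3 := congrArg (fun ν => ∫⁻ x, F x ∂ν) key
  rw [lintegral_map hF (hU0.prodMk hθ), lintegral_map hF hm1] at h3
  exact h3.trans (Measure.lintegral_compProd (μ := P) (κ := T.comap (Z k) (h.1 k)) (hF.comp hm1))

end MC


section Erg

theorem maximal_ergodic {Q : Measure Ω} [IsProbabilityMeasure Q] {θ : Ω → Ω}
    (hθ : MeasurePreserving θ Q Q) {f : Ω → ℝ} (hf : Measurable f) (hb : ∀ ω, |f ω| ≤ 1)
    (hD : ∀ᵐ ω ∂Q, ∃ n : ℕ, 0 < ∑ k ∈ Finset.range n, f (θ^[k] ω)) : 0 ≤ ∫ ω, f ω ∂Q := by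
  let M : ℕ → Ω → ℝ := fun n => Nat.rec (fun _ => 0) (fun _ g ω => max 0 (f ω + g (θ ω))) n
  have M0 : ∀ ω, M 0 ω = 0 := fun ω => rfl
  have Ms : ∀ n ω, M (n + 1) ω = max 0 (f ω + M n (θ ω)) := fun n ω => rfl
  have Mnn : ∀ n ω, 0 ≤ M n ω := by
    intro n ω; cases n with
    | zero => exact le_rfl
    | succ n => rw [Ms]; exact le_max_left _ _
  have Mmono : ∀ n ω, M n ω ≤ M (n + 1) ω := by
    intro n; induction n with
    | zero => intro ω; exact Mnn 1 ω
    | succ n ih =>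
      intro ω; rw [Ms n, Ms (n + 1)]
      exact max_le_max le_rfl (by linarith [ih (θ ω)])
  have Mmeas : ∀ n, Measurable (M n) := by
    intro n; induction n with
    | zero => exact measurable_const
    | succ n ih => exact measurable_const.max (hf.add (ih.comp hθ.measurable))
  have Mub : ∀ n ω, M n ω ≤ n := by
    intro n; induction n with
    | zero => intro ω; simp [M0]
    | succ n ih =>
      intro ω; rw [Ms]
      have h1 := ih (θ ω); have h2 := (abs_le.1 (hb ω)).2
      push_cast
      exact max_le (by positivity) (by linarith)
  have Mint : ∀ n, Integrable (M n) Q := fun n =>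
    Integrable.of_bound (Mmeas n).aestronglyMeasurable (n : ℝ)
      (Filter.Eventually.of_forall fun ω => by
        rw [Real.norm_eq_abs, abs_of_nonneg (Mnn n ω)]; exact Mub n ω)
  have Asum : ∀ n ω, ∑ k ∈ Finset.range n, f (θ^[k] ω) ≤ M n ω := by
    intro n; induction n with
    | zero => intro ω; simp [M0]
    | succ n ih =>
      intro ω
      rw [Finset.sum_range_succ', Ms]
      refine le_trans ?_ (le_max_right _ _)
      have := ih (θ ω)
      simp only [Function.iterate_succ, Function.comp, Function.iterate_zero, id] at *
      linarith
  have step : ∀ n, 0 ≤ ∫ ω, ({ω | 0 < M (n + 1) ω}.indicator f) ω ∂Q := by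
    intro n
    have hMθ : Integrable (fun ω => M (n + 1) (θ ω)) Q :=
      hθ.integrable_comp_of_integrable (Mint (n + 1))
    have hsub : Integrable (fun ω => M (n + 1) ω - M (n + 1) (θ ω)) Q := (Mint (n + 1)).sub hMθ
    have hs : MeasurableSet {ω | 0 < M (n + 1) ω} :=
      measurableSet_lt measurable_const (Mmeas (n + 1))
    have h1 : ∫ ω, (M (n + 1) ω - M (n + 1) (θ ω)) ∂Q = 0 := by
      rw [integral_sub (Mint (n + 1)) hMθ]
      rw [← integral_map (f := M (n + 1)) hθ.measurable.aemeasurable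
        (by rw [hθ.map_eq]; exact (Mmeas (n + 1)).aestronglyMeasurable), hθ.map_eq, sub_self]
    refine h1.symm.le.trans (integral_mono hsub ?_ ?_)
    · refine Integrable.indicator ?_ hs
      exact Integrable.of_bound hf.aestronglyMeasurable 1 (Filter.Eventually.of_forall hb)
    · intro ω
      by_cases h : 0 < M (n + 1) ω
      · simp only [Set.indicator, Set.mem_ofPred_eq, h, if_true]
        have h2 := Ms n ω
        have h3 := Mmono n (θ ω)
        rcases max_choice 0 (f ω + M n (θ ω)) with h4 | h4
        · rw [h4] at h2; linarith
        · rw [h4] at h2; linarith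
      · simp only [Set.indicator, Set.mem_ofPred_eq, h, if_false]
        linarith [Mnn (n + 1) (θ ω), not_lt.1 h]
  have lim : Filter.Tendsto (fun n => ∫ ω, ({ω | 0 < M (n + 1) ω}.indicator f) ω ∂Q)
      Filter.atTop (nhds (∫ ω, f ω ∂Q)) := by
    refine tendsto_integral_of_dominated_convergence (fun _ => 1) ?_ (integrable_const _) ?_ ?_
    · intro n
      have hs : MeasurableSet {ω | 0 < M (n + 1) ω} :=
        measurableSet_lt measurable_const (Mmeas (n + 1))
      exact (hf.indicator hs).aestronglyMeasurable
    · intro n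
      refine Filter.Eventually.of_forall fun ω => ?_
      exact (norm_indicator_le_norm_self _ _).trans (hb ω)
    · filter_upwards [hD] with ω ⟨n, hn⟩
      refine tendsto_const_nhds.congr' ?_
      filter_upwards [Filter.eventually_ge_atTop n] with m hm
      have h1 : M n ω ≤ M (m + 1) ω :=
        monotone_nat_of_le_succ (f := fun n => M n ω) (fun n => Mmono n ω) (show n ≤ m + 1 by omega)
      have : 0 < M (m + 1) ω := hn.trans_le ((Asum n ω).trans h1)
      simp [Set.indicator, this]
  exact ge_of_tendsto' lim step

variable {S : Type*} [MeasurableSpace S]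

/-- The coordinate filtration. -/
def coordFil : Filtration ℕ (MeasurableSpace.pi : MeasurableSpace (ℕ → S)) where
  seq k := ⨆ i ∈ Set.Iic k, MeasurableSpace.comap (fun η : ℕ → S => η i) inferInstance
  mono' _ _ hkl := biSup_mono fun _ hi => (Set.mem_Iic.2 ((Set.mem_Iic.1 hi).trans hkl))
  le' _ := iSup₂_le fun i _ => (measurable_pi_apply i).comap_le

theorem coordFil_sup : (⨆ k, (coordFil (S := S)) k) = MeasurableSpace.pi := by
  refine le_antisymm (iSup_le fun k => coordFil.le k) ?_
  refine iSup_le fun i => ?_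
  refine le_iSup_of_le i ?_
  exact le_iSup₂_of_le (f := fun (j : ℕ) (_ : j ∈ Set.Iic i) =>
    MeasurableSpace.comap (fun η : ℕ → S => η j) inferInstance) i (Set.mem_Iic.2 le_rfl) le_rfl

theorem inv_shift {D : Set (ℕ → S)} (hinv : ∀ η : ℕ → S, (fun i => η (i + 1)) ∈ D ↔ η ∈ D)
    (k : ℕ) (η : ℕ → S) : (fun i => η (k + i)) ∈ D ↔ η ∈ D := by
  induction k with
  | zero => simp
  | succ k ih =>
    rw [← ih, ← hinv (fun i => η (k + i))]
    simp only [show ∀ i, k + 1 + i = k + (i + 1) from fun i => by ring]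

theorem levy_path {κ : Kernel S S} {T : Kernel S (ℕ → S)} [IsMarkovKernel T]
    (hT : IsPathK κ T) (hmc : ∀ z, IsMarkovChain (T z) (fun i (η : ℕ → S) => η i) κ)
    {D : Set (ℕ → S)} (hD : MeasurableSet D)
    (hinv : ∀ η : ℕ → S, (fun i => η (i + 1)) ∈ D ↔ η ∈ D) (z : S) :
    ∀ᵐ η ∂(T z), Filter.Tendsto (fun k : ℕ => (T (η k) D).toReal) Filter.atTop
      (nhds (D.indicator (fun _ => (1 : ℝ)) η)) := by
  have hintg : Integrable (D.indicator (fun _ => (1 : ℝ))) (T z) :=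
    (integrable_const _).indicator hD
  have h1 := hintg.tendsto_ae_condExp (ℱ := coordFil (S := S))
    (by rw [coordFil_sup]; exact (measurable_const.indicator hD).stronglyMeasurable)
  have hmeas : Measurable (fun z => T z D) := T.measurable_coe hD
  have h2 : ∀ k : ℕ, (fun η : ℕ → S => (T (η k) D).toReal) =ᵐ[T z]
      (T z)[D.indicator (fun _ => (1 : ℝ)) | coordFil (S := S) k] := by
    intro k
    have hm : Measurable[coordFil (S := S) k] (fun η : ℕ → S => (T (η k) D).toReal) := by
      have h0 : Measurable[coordFil (S := S) k] (fun η : ℕ → S => η k) := by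
        rw [measurable_iff_comap_le]
        exact le_iSup₂_of_le (f := fun (j : ℕ) (_ : j ∈ Set.Iic k) =>
          MeasurableSpace.comap (fun η : ℕ → S => η j) inferInstance) k (Set.mem_Iic.2 le_rfl) le_rfl
      exact hmeas.ennreal_toReal.comp h0
    have hbd : Integrable (fun η : ℕ → S => (T (η k) D).toReal) (T z) := by
      refine Integrable.of_bound (hm.mono (coordFil.le k) le_rfl).aestronglyMeasurable 1
        (Filter.Eventually.of_forall fun η => ?_)
      rw [Real.norm_eq_abs, abs_of_nonneg ENNReal.toReal_nonneg]
      exact ENNReal.toReal_le_of_le_ofReal zero_le_one (by simpa using prob_le_one)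
    refine ae_eq_condExp_of_forall_setIntegral_eq (coordFil.le k) hintg
      (fun C _ _ => hbd.integrableOn) ?_ hm.stronglyMeasurable.aestronglyMeasurable
    intro C hC _
    have hC0 : MeasurableSet C := coordFil.le k _ hC
    have h3 := mc_set (hmc z) hT k hC hD
    have hmk : Measurable (fun η : ℕ → S => T (η k) D) :=
      hmeas.comp (measurable_pi_apply (X := fun _ : ℕ => S) k)
    rw [integral_toReal hmk.aemeasurable
      (Filter.Eventually.of_forall fun η => measure_lt_top _ _)]
    rw [setIntegral_indicator hD, setIntegral_const, smul_eq_mul, mul_one]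
    rw [Measure.real]
    congr 1
    rw [← h3]
    congr 1
    ext η
    simp only [Set.mem_inter_iff, Set.mem_ofPred_eq, inv_shift hinv]
  filter_upwards [h1, ae_all_iff.2 h2] with η h3 h4
  exact h3.congr fun k => (h4 k).symm

theorem zero_one {κ : Kernel S S} {T : Kernel S (ℕ → S)} [IsMarkovKernel T]
    (hT : IsPathK κ T) (hmc : ∀ z, IsMarkovChain (T z) (fun i (η : ℕ → S) => η i) κ)
    {ψ : Measure S} (hψ : 0 < ψ Set.univ) (hH : HarrisProp κ (fun z => T z) ψ)
    {D : Set (ℕ → S)} (hD : MeasurableSet D)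
    (hinv : ∀ η : ℕ → S, (fun i => η (i + 1)) ∈ D ↔ η ∈ D) :
    (∀ z, T z Dᶜ = 0) ∨ (∀ z, T z D = 0) := by
  have hmeas : Measurable (fun z => (T z D).toReal) := (T.measurable_coe hD).ennreal_toReal
  have hA : MeasurableSet {z | (1 / 2 : ℝ) ≤ (T z D).toReal} :=
    measurableSet_le measurable_const hmeas
  have hinf : ∀ A : Set S, MeasurableSet A → 0 < ψ A → ∀ z, ∀ᵐ η ∂(T z),
      ∀ N : ℕ, ∃ k : ℕ, N ≤ k ∧ η k ∈ A := by
    intro A hA hp z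
    have hm : MeasurableSet {η : ℕ → S | ∀ N : ℕ, ∃ k : ℕ, N ≤ k ∧ η k ∈ A} := by
      have : {η : ℕ → S | ∀ N : ℕ, ∃ k : ℕ, N ≤ k ∧ η k ∈ A} =
        ⋂ N : ℕ, ⋃ k : ℕ, ⋃ (_ : N ≤ k), (fun η : ℕ → S => η k) ⁻¹' A := by
        ext; simp
      rw [this]
      exact MeasurableSet.iInter fun N => MeasurableSet.iUnion fun k => MeasurableSet.iUnion
        fun _ => (measurable_pi_apply k) hA
    exact (prob_compl_eq_zero_iff hm).2 (hH A hA hp z)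
  by_cases h : 0 < ψ {z | (1 / 2 : ℝ) ≤ (T z D).toReal}
  · left
    intro z
    have : ∀ᵐ η ∂(T z), η ∈ D := by
      filter_upwards [levy_path hT hmc hD hinv z, hinf _ hA h z] with η h1 h2
      by_contra hη
      rw [Set.indicator_of_notMem hη] at h1
      obtain ⟨N, hN⟩ := Filter.eventually_atTop.1 (h1.eventually (gt_mem_nhds (show (0:ℝ) < 1/2 by norm_num)))
      obtain ⟨k, hk, hk2⟩ := h2 N
      exact absurd (hN k hk) (not_lt.2 hk2)
    exact this
  · right
    intro z
    have hc : 0 < ψ {z | (1 / 2 : ℝ) ≤ (T z D).toReal}ᶜ := by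
      by_contra h2
      have h3 := measure_union_le (μ := ψ) {z | (1 / 2 : ℝ) ≤ (T z D).toReal}
        {z | (1 / 2 : ℝ) ≤ (T z D).toReal}ᶜ
      rw [Set.union_compl_self, nonpos_iff_eq_zero.1 (not_lt.1 h), nonpos_iff_eq_zero.1 (not_lt.1 h2),
        add_zero] at h3
      exact absurd hψ (not_lt.2 h3)
    have : ∀ᵐ η ∂(T z), η ∉ D := by
      filter_upwards [levy_path hT hmc hD hinv z, hinf _ hA.compl hc z] with η h1 h2
      intro hη
      rw [Set.indicator_of_mem hη] at h1
      obtain ⟨N, hN⟩ := Filter.eventually_atTop.1 (h1.eventually (lt_mem_nhds (show (1/2:ℝ) < 1 by norm_num)))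
      obtain ⟨k, hk, hk2⟩ := h2 N
      exact hk2 (hN k hk).le
    have h5 := ae_iff.1 this
    simpa using h5

theorem T_shift {κ : Kernel S S} {T : Kernel S (ℕ → S)} [IsMarkovKernel T]
    (hT : IsPathK κ T) (hmc : ∀ z, IsMarkovChain (T z) (fun i (η : ℕ → S) => η i) κ)
    (hst : ∀ z, ∀ᵐ η ∂(T z), η 0 = z) {B : Set (ℕ → S)} (hB : MeasurableSet B) (z : S) :
    T z {η | (fun i => η (i + 1)) ∈ B} = ∫⁻ z', T z' B ∂(κ z) := by
  have h1 := mc_set (hmc z) hT 1 (C := Set.univ) MeasurableSet.univ hB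
  simp only [Set.univ_inter, Measure.restrict_univ] at h1
  have h2 := (hmc z).2 0 (fun z' => T z' B) (T.measurable_coe hB) Set.univ MeasurableSet.univ
  simp only [Measure.restrict_univ, zero_add] at h2
  have h3 : ∫⁻ η, ∫⁻ z', T z' B ∂(κ (η 0)) ∂(T z) = ∫⁻ z', T z' B ∂(κ z) := by
    rw [lintegral_congr_ae (g := fun _ => ∫⁻ z', T z' B ∂(κ z))
      (by filter_upwards [hst z] with η hη; rw [hη])]
    simp only [lintegral_const, measure_univ, mul_one]
  rw [h3] at h2
  rw [← h2, ← h1]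
  simp only [add_comm]

theorem frequency {κ : Kernel S S} {T : Kernel S (ℕ → S)} [IsMarkovKernel T]
    (hT : IsPathK κ T) (hmc : ∀ z, IsMarkovChain (T z) (fun i (η : ℕ → S) => η i) κ)
    (hst : ∀ z, ∀ᵐ η ∂(T z), η 0 = z)
    {ψ : Measure S} (hψ : 0 < ψ Set.univ) (hH : HarrisProp κ (fun z => T z) ψ)
    {π : Measure S} [IsProbabilityMeasure π] (hπ : IsInvariantMeasure κ π)
    {G : Set (ℕ → S)} (hG : MeasurableSet G) (hpos : 0 < ∫⁻ z, T z G ∂π) :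
    ∃ c : ℝ, 0 < c ∧ ∀ z, ∀ᵐ η ∂(T z), ∃ K : ℕ, ∀ n : ℕ,
      c * n - K ≤ ∑ k ∈ Finset.range n, G.indicator (fun _ => (1 : ℝ)) (fun i => η (k + i)) := by
  set Q : Measure (ℕ → S) := π.bind T with hQ
  have hQa : ∀ B : Set (ℕ → S), MeasurableSet B → Q B = ∫⁻ z, T z B ∂π := fun B hB =>
    Measure.bind_apply hB (Kernel.aemeasurable _)
  have : IsProbabilityMeasure Q := ⟨by rw [hQa _ MeasurableSet.univ]; simp⟩
  have hθm : Measurable (fun (η : ℕ → S) i => η (i + 1)) :=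
    measurable_pi_lambda _ fun i => measurable_pi_apply _
  have hθ : MeasurePreserving (fun (η : ℕ → S) i => η (i + 1)) Q Q := by
    refine ⟨hθm, ?_⟩
    ext B hB
    rw [Measure.map_apply hθm hB, hQa _ (hθm hB), hQa _ hB]
    have h1 : ∀ z, T z ((fun (η : ℕ → S) i => η (i + 1)) ⁻¹' B) = ∫⁻ z', T z' B ∂(κ z) :=
      fun z => T_shift hT hmc hst hB z
    simp_rw [h1]
    conv_rhs => rw [← hπ]
    exact (Measure.lintegral_bind (Kernel.aemeasurable κ) (T.measurable_coe hB).aemeasurable).symm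
  set c : ℝ := Q.real G / 2 with hc
  have hQG : 0 < Q.real G := by
    rw [Measure.real, hQa _ hG]
    refine ENNReal.toReal_pos hpos.ne' ?_
    rw [← hQa _ hG]; exact measure_ne_top _ _
  have hQ1 : Q.real G ≤ 1 := by
    simpa using measureReal_mono (μ := Q) (Set.subset_univ G)
  refine ⟨c, by positivity, ?_⟩
  set f : (ℕ → S) → ℝ := fun η => c - G.indicator (fun _ => (1 : ℝ)) η with hf
  have hfm : Measurable f := measurable_const.sub (measurable_const.indicator hG)
  have hshm : ∀ k : ℕ, Measurable (fun (η : ℕ → S) i => η (k + i)) := fun k =>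
    measurable_pi_lambda _ fun i => measurable_pi_apply _
  set D : Set (ℕ → S) := {η | ∀ K : ℕ, ∃ n : ℕ, (K : ℝ) <
    ∑ k ∈ Finset.range n, f (fun i => η (k + i))} with hDdef
  have hD : MeasurableSet D := by
    have : D = ⋂ K : ℕ, ⋃ n : ℕ, {η | (K : ℝ) < ∑ k ∈ Finset.range n, f (fun i => η (k + i))} := by
      ext; simp [hDdef]
    rw [this]
    exact MeasurableSet.iInter fun K => MeasurableSet.iUnion fun n =>
      measurableSet_lt measurable_const
        (Finset.measurable_sum _ fun k _ => hfm.comp (hshm k))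
  have hsum : ∀ (η : ℕ → S) n, ∑ k ∈ Finset.range (n + 1), f (fun i => η (k + i)) =
      (∑ k ∈ Finset.range n, f (fun i => η (k + i + 1))) + f η := by
    intro η n
    rw [Finset.sum_range_succ']
    simp only [zero_add]
    congr 1
    refine Finset.sum_congr rfl fun k _ => ?_
    simp only [show ∀ i, k + 1 + i = k + i + 1 from fun i => by ring]
  have hfb : ∀ η, |f η| ≤ 1 := by
    intro η
    have h0 : 0 ≤ G.indicator (fun _ => (1 : ℝ)) η :=
      Set.indicator_nonneg (fun _ _ => zero_le_one) _
    have h1 : G.indicator (fun _ => (1 : ℝ)) η ≤ 1 :=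
      Set.indicator_le_self' (fun _ _ => zero_le_one) _
    rw [abs_le]; constructor <;> simp only [hf] <;> linarith
  have hinv : ∀ η : ℕ → S, (fun i => η (i + 1)) ∈ D ↔ η ∈ D := by
    intro η
    simp only [hDdef, Set.mem_ofPred_eq]
    constructor
    · intro h K
      obtain ⟨n, hn⟩ := h (K + 1)
      refine ⟨n + 1, ?_⟩
      rw [hsum]
      have := (abs_le.1 (hfb η)).1
      push_cast at hn
      linarith
    · intro h K
      obtain ⟨n, hn⟩ := h (K + 1)
      cases n with
      | zero => 
        exfalso
        simp only [Finset.range_zero, Finset.sum_empty] at hn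
        exact absurd hn (not_lt.2 (Nat.cast_nonneg _))
      | succ n =>
        refine ⟨n, ?_⟩
        rw [hsum] at hn
        have := (abs_le.1 (hfb η)).2
        push_cast at hn
        linarith
  rcases zero_one hT hmc hψ hH hD hinv with h | h
  · exfalso
    have hQD : ∀ᵐ η ∂Q, η ∈ D := by
      rw [ae_iff]
      change Q Dᶜ = 0
      rw [hQa _ hD.compl]; simp [h]
    have hiter : ∀ (k : ℕ) (η : ℕ → S), (fun (η : ℕ → S) i => η (i + 1))^[k] η = fun i => η (k + i) := by
      intro k; induction k with
      | zero => intro η; simp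
      | succ k ih =>
        intro η; rw [Function.iterate_succ_apply, ih]
        simp only [show ∀ i, k + 1 + i = k + i + 1 from fun i => by ring]
    have h1 := maximal_ergodic hθ hfm hfb (by
      filter_upwards [hQD] with η hη
      obtain ⟨n, hn⟩ := hη 0
      refine ⟨n, ?_⟩
      simp only [hiter]
      simpa using hn)
    rw [integral_sub (integrable_const _) ((integrable_const _).indicator hG),
      integral_indicator_const _ hG] at h1
    simp at h1
    linarith
  · intro z
    have h1 : ∀ᵐ η ∂(T z), η ∉ D := by rw [ae_iff]; simpa using h z
    filter_upwards [h1] with η hη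
    simp only [hDdef, Set.mem_ofPred_eq, not_forall, not_exists, not_lt] at hη
    obtain ⟨K, hK⟩ := hη
    refine ⟨K, fun n => ?_⟩
    have := hK n
    simp only [hf, Finset.sum_sub_distrib, Finset.sum_const, Finset.card_range, nsmul_eq_mul] at this
    linarith

theorem pi_pos {κ : Kernel S S} {ψ π : Measure S} [IsProbabilityMeasure π]
    (hπ : IsInvariantMeasure κ π) (hψ : IsIrreducibilityMeasure κ ψ) {B : Set S}
    (hB : MeasurableSet B) (hpos : 0 < ψ B) : 0 < π B := by
  have hk : ∀ k, ∫⁻ z, kpow κ k z B ∂π = π B := by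
    intro k
    induction k with
    | zero =>
      simp only [kpow, Kernel.id_apply]
      simp_rw [Measure.dirac_apply' _ hB]
      rw [lintegral_indicator_one hB]
    | succ k ih =>
      simp only [kpow]
      simp_rw [Kernel.comp_apply' _ _ _ hB]
      rw [← ih]
      conv_rhs => rw [← hπ]
      exact (Measure.lintegral_bind (Kernel.aemeasurable κ)
        ((kpow κ k).measurable_coe hB).aemeasurable).symm
  by_contra h0
  have h0 : π B = 0 := nonpos_iff_eq_zero.1 (not_lt.1 h0)
  have h1 : ∀ k, ∀ᵐ z ∂π, kpow κ k z B = 0 := by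
    intro k
    have := (hk k).trans h0
    rwa [lintegral_eq_zero_iff ((kpow κ k).measurable_coe hB)] at this
  have h2 : ∀ᵐ z ∂π, False := by
    filter_upwards [ae_all_iff.2 h1] with z hz
    obtain ⟨k, _, hk⟩ := hψ B hB hpos z
    exact hk.ne' (hz k)
  have : π Set.univ = 0 := by simpa [ae_iff] using h2
  simp at this

end Erg


section Dens

variable {κ : Kernel (𝓧 × 𝓨) (𝓧 × 𝓨)} {q : 𝓧 × 𝓨 → 𝓧 × 𝓨 → ℝ≥0∞} {μ : Measure 𝓧}
  {T : Kernel (𝓧 × 𝓨) (ℕ → 𝓧 × 𝓨)}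

/-- Backward functions. -/
noncomputable def Bf (q : 𝓧 × 𝓨 → 𝓧 × 𝓨 → ℝ≥0∞) (κ : Kernel (𝓧 × 𝓨) (𝓧 × 𝓨)) (K : ℕ) :
    ℕ → (ℕ → Set (𝓧 × 𝓨)) → (ℕ → 𝓧) → 𝓨 → ℝ≥0∞
  | 0, A, x, y => Lc κ K A (x 0, y)
  | N + 1, A, x, y => (A 0).indicator (fun _ =>
      ∑ j, q (x 1, j) (x 0, y) * Bf q κ K N (fun i => A (i + 1)) (fun i => x (i + 1)) j) (x 0, y)

theorem measurable_Bf (hq : Measurable (Function.uncurry q)) (K N : ℕ) :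
    ∀ (A : ℕ → Set (𝓧 × 𝓨)), (∀ i, MeasurableSet (A i)) → ∀ y,
      Measurable (fun x : ℕ → 𝓧 => Bf q κ K N A x y) := by
  induction N with
  | zero =>
    intro A hA y
    have h0 : Measurable (fun x : ℕ → 𝓧 => (x 0, y)) :=
      (measurable_pi_apply (X := fun _ : ℕ => 𝓧) 0).prodMk measurable_const
    exact (measurable_Lc κ K A hA).comp h0
  | succ N ih =>
    intro A hA y
    have h0 : Measurable (fun x : ℕ → 𝓧 => (x 0, y)) :=
      (measurable_pi_apply (X := fun _ : ℕ => 𝓧) 0).prodMk measurable_const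
    have h1 : ∀ j : 𝓨, Measurable (fun x : ℕ → 𝓧 => ((x 1, j), (x 0, y))) := fun j =>
      ((measurable_pi_apply (X := fun _ : ℕ => 𝓧) 1).prodMk measurable_const).prodMk h0
    have hs : Measurable (fun (x : ℕ → 𝓧) i => x (i + 1)) :=
      measurable_pi_lambda _ fun i => measurable_pi_apply _
    have h2 : Measurable (fun x : ℕ → 𝓧 =>
      ∑ j, q (x 1, j) (x 0, y) * Bf q κ K N (fun i => A (i + 1)) (fun i => x (i + 1)) j) := by
      refine Finset.measurable_sum _ fun j _ => Measurable.mul ?_ ?_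
      · exact hq.comp (h1 j)
      · exact (ih _ (fun i => hA (i + 1)) j).comp hs
    exact h2.indicator (h0 (hA 0))

theorem Bf_congr (K N : ℕ) : ∀ (A : ℕ → Set (𝓧 × 𝓨)) (x x' : ℕ → 𝓧) (y : 𝓨),
    (∀ i ≤ N, x i = x' i) → Bf q κ K N A x y = Bf q κ K N A x' y := by
  induction N with
  | zero => intro A x x' y h; simp only [Bf]; rw [h 0 le_rfl]
  | succ N ih =>
    intro A x x' y h
    simp only [Bf]
    rw [h 0 (by omega), h 1 (by omega)]
    congr 1; ext z
    refine Finset.sum_congr rfl fun j _ => ?_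
    rw [ih (fun i => A (i + 1)) (fun i => x (i + 1)) (fun i => x' (i + 1)) j
      (fun i hi => h (i + 1) (by omega))]

theorem Bf_ne_top [IsMarkovKernel κ] (hq : ∀ z z', q z z' ≠ ∞) (K N : ℕ) :
    ∀ (A : ℕ → Set (𝓧 × 𝓨)) (x : ℕ → 𝓧) (y : 𝓨), Bf q κ K N A x y ≠ ∞ := by
  induction N with
  | zero => intro A x y; exact ((Lc_le_one κ K A _).trans_lt one_lt_top).ne
  | succ N ih =>
    intro A x y
    simp only [Bf, Set.indicator]
    split_ifs
    · refine (ENNReal.sum_lt_top.2 fun j _ => ?_).ne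
      exact ENNReal.mul_lt_top (hq _ _).lt_top (ih _ _ _).lt_top
    · simp

/-- Extension of a finite string. -/
def exf {N : ℕ} (w : Fin (N + 1) → 𝓧) : ℕ → 𝓧 := fun i => w ⟨min i N, by omega⟩

theorem exf_zero {N : ℕ} (w : Fin (N + 1) → 𝓧) : exf w 0 = w 0 := by
  simp [exf]

theorem exf_cons {N : ℕ} (a : 𝓧) (w : Fin (N + 1) → 𝓧) :
    (fun i => exf (Fin.cons a w : Fin (N + 2) → 𝓧) (i + 1)) = exf w := by
  funext i
  simp only [exf]
  have : (⟨min (i + 1) (N + 1), by omega⟩ : Fin (N + 2)) = Fin.succ ⟨min i N, by omega⟩ := by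
    ext; simp
  rw [this, Fin.cons_succ]

theorem exf_apply {N : ℕ} (w : Fin (N + 1) → 𝓧) (i : ℕ) (hi : i ≤ N) :
    exf w i = w ⟨i, by omega⟩ := by
  simp [exf, hi]

theorem measurable_exf {N : ℕ} : Measurable (exf : (Fin (N + 1) → 𝓧) → ℕ → 𝓧) :=
  measurable_pi_lambda _ fun i => measurable_pi_apply _

theorem measurable_cons {N : ℕ} {α : Type*} [MeasurableSpace α] {f : α → 𝓧}
    {g : α → Fin N → 𝓧} (hf : Measurable f) (hg : Measurable g) :
    Measurable (fun a => (Fin.cons (f a) (g a) : Fin (N + 1) → 𝓧)) := by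
  refine measurable_pi_lambda _ fun i => ?_
  refine Fin.cases ?_ (fun j => ?_) i
  · simpa using hf
  · have h := (measurable_pi_apply j).comp hg
    simpa [Function.comp_def] using h

theorem lint_pi_succ [SigmaFinite μ] {N : ℕ} {F : (Fin (N + 1) → 𝓧) → ℝ≥0∞}
    (hF : Measurable F) : ∫⁻ x, F x ∂(Measure.pi fun _ : Fin (N + 1) => μ) =
      ∫⁻ a, ∫⁻ x, F (Fin.cons a x) ∂(Measure.pi fun _ : Fin N => μ) ∂μ := by
  have h := (measurePreserving_piFinSuccAbove (fun _ : Fin (N + 1) => μ) 0).symm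
  rw [← h.lintegral_comp hF, lintegral_prod]
  · refine lintegral_congr fun a => lintegral_congr fun x => ?_
    congr 1
    exact Fin.insertNth_zero' a x
  · exact (hF.comp h.measurable).aemeasurable

theorem T_shift_lint [IsMarkovKernel T]
    (hT : IsPathK κ T) (hmc : ∀ z, IsMarkovChain (T z) (fun i (η : ℕ → 𝓧 × 𝓨) => η i) κ)
    (hst : ∀ z, ∀ᵐ η ∂(T z), η 0 = z) {F : (ℕ → 𝓧 × 𝓨) → ℝ≥0∞} (hF : Measurable F) (z : 𝓧 × 𝓨) :
    ∫⁻ η, F (fun i => η (i + 1)) ∂(T z) = ∫⁻ z', ∫⁻ η, F η ∂(T z') ∂(κ z) := by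
  have hθm : Measurable (fun (η : ℕ → 𝓧 × 𝓨) i => η (i + 1)) :=
    measurable_pi_lambda _ fun i => measurable_pi_apply _
  have : (T z).map (fun (η : ℕ → 𝓧 × 𝓨) i => η (i + 1)) = (κ z).bind T := by
    ext B hB
    rw [Measure.map_apply hθm hB, Measure.bind_apply hB (Kernel.aemeasurable _)]
    exact T_shift hT hmc hst hB z
  rw [← lintegral_map hF hθm, this, Measure.lintegral_bind (Kernel.aemeasurable _) hF.aemeasurable]

theorem lint_kernel [SigmaFinite μ] (hq : Measurable (Function.uncurry q))
    (hκ : ∀ z, (κ z : Measure (𝓧 × 𝓨)) = (μ.prod Measure.count).withDensity (fun z' => q z' z))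
    (z : 𝓧 × 𝓨) {F : 𝓧 × 𝓨 → ℝ≥0∞} (hF : Measurable F) :
    ∫⁻ z', F z' ∂(κ z) = ∫⁻ a, ∑ j, q (a, j) z * F (a, j) ∂μ := by
  have hqz : Measurable (fun z' => q z' z) := hq.comp (measurable_id.prodMk measurable_const)
  rw [hκ, lintegral_withDensity_eq_lintegral_mul _ hqz hF,
    lintegral_prod _ (hqz.mul hF).aemeasurable]
  refine lintegral_congr fun a => ?_
  rw [lintegral_count, tsum_fintype]
  rfl

theorem density [IsMarkovKernel T] [SigmaFinite μ]
    (hT : IsPathK κ T) (hmc : ∀ z, IsMarkovChain (T z) (fun i (η : ℕ → 𝓧 × 𝓨) => η i) κ)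
    (hst : ∀ z, ∀ᵐ η ∂(T z), η 0 = z) (hq : Measurable (Function.uncurry q))
    (hκ : ∀ z, (κ z : Measure (𝓧 × 𝓨)) = (μ.prod Measure.count).withDensity (fun z' => q z' z))
    (K N : ℕ) : ∀ (A : ℕ → Set (𝓧 × 𝓨)), (∀ i, MeasurableSet (A i)) →
    ∀ (H : (Fin N → 𝓧) → ℝ≥0∞), Measurable H → ∀ z : 𝓧 × 𝓨,
    ∫⁻ η, H (fun i => (η (i + 1)).1) * {η : ℕ → 𝓧 × 𝓨 | ∀ i < N + K, η i ∈ A i}.indicator 1 η ∂(T z) =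
      ∫⁻ x, H x * Bf q κ K N A (exf (Fin.cons z.1 x : Fin (N + 1) → 𝓧)) z.2
        ∂(Measure.pi fun _ : Fin N => μ) := by
  have hcyl : ∀ M (A : ℕ → Set (𝓧 × 𝓨)), (∀ i, MeasurableSet (A i)) →
      MeasurableSet {η : ℕ → 𝓧 × 𝓨 | ∀ i < M, η i ∈ A i} := by
    intro M A hA
    have : {η : ℕ → 𝓧 × 𝓨 | ∀ i < M, η i ∈ A i} =
        ⋂ i : ℕ, ⋂ (_ : i < M), (fun η : ℕ → 𝓧 × 𝓨 => η i) ⁻¹' (A i) := by ext; simp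
    rw [this]
    exact MeasurableSet.iInter fun i => MeasurableSet.iInter fun _ => measurable_pi_apply i (hA i)
  have hX : ∀ N, Measurable (fun (η : ℕ → 𝓧 × 𝓨) (i : Fin N) => (η (i + 1)).1) := fun N =>
    measurable_pi_lambda _ fun i => measurable_fst.comp (measurable_pi_apply _)
  induction N with
  | zero =>
    intro A hA H hH z
    have h1 : ∀ x : Fin 0 → 𝓧, x = default := fun x => Subsingleton.elim _ _
    simp only [h1]
    rw [lintegral_const_mul _ (measurable_one.indicator (hcyl _ A hA)),
      lintegral_indicator_one (hcyl _ A hA)]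
    simp only [Bf, exf_zero, lintegral_const]
    rw [Measure.pi_of_empty]
    simp only [zero_add]
    rw [hT K A hA z]
    simp
  | succ N ih =>
    intro A hA H hH z
    set A' : ℕ → Set (𝓧 × 𝓨) := fun i => A (i + 1) with hA'
    have hA'm : ∀ i, MeasurableSet (A' i) := fun i => hA _
    set F : (ℕ → 𝓧 × 𝓨) → ℝ≥0∞ := fun η => H (Fin.cons (η 0).1 (fun i : Fin N => (η (i + 1)).1)) *
      {η : ℕ → 𝓧 × 𝓨 | ∀ i < N + K, η i ∈ A' i}.indicator 1 η with hF
    have h0 : Measurable (fun η : ℕ → 𝓧 × 𝓨 => (η 0).1) :=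
      measurable_fst.comp (measurable_pi_apply (X := fun _ : ℕ => 𝓧 × 𝓨) 0)
    have hFm : Measurable F :=
      (hH.comp (measurable_cons h0 (hX N))).mul (measurable_one.indicator (hcyl _ A' hA'm))
    have e1 : ∫⁻ η, H (fun i => (η (i + 1)).1) *
        {η : ℕ → 𝓧 × 𝓨 | ∀ i < N + 1 + K, η i ∈ A i}.indicator 1 η ∂(T z) =
        ∫⁻ η, (A 0).indicator 1 z * F (fun i => η (i + 1)) ∂(T z) := by
      refine lintegral_congr_ae ?_
      filter_upwards [hst z] with η hη
      have e2 : (fun i : Fin (N + 1) => (η (i + 1)).1) =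
          Fin.cons (η 1).1 (fun i : Fin N => (η (i + 1 + 1)).1) := by
        funext i
        refine Fin.cases ?_ (fun j => ?_) i <;> simp
      have e3 : (∀ i < N + 1 + K, η i ∈ A i) ↔ (z ∈ A 0 ∧ ∀ i < N + K, η (i + 1) ∈ A (i + 1)) := by
        constructor
        · intro h
          exact ⟨hη ▸ h 0 (by omega), fun i hi => h (i + 1) (by omega)⟩
        · rintro ⟨h1, h2⟩ i hi
          cases i with
          | zero => exact hη ▸ h1
          | succ i => exact h2 i (by omega)
      simp only [hF, e2, Set.indicator, Set.mem_ofPred_eq, hA', zero_add, Pi.one_apply]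
      by_cases h1 : z ∈ A 0
      · by_cases h2 : ∀ i < N + K, η (i + 1) ∈ A (i + 1)
        · rw [if_pos (e3.2 ⟨h1, h2⟩), if_pos h1, if_pos h2, one_mul]
        · rw [if_neg (fun h => h2 (e3.1 h).2), if_neg h2]; simp
      · rw [if_neg (fun h => h1 (e3.1 h).1), if_neg h1]; simp
    have hθm : Measurable (fun (η : ℕ → 𝓧 × 𝓨) i => η (i + 1)) :=
      measurable_pi_lambda _ fun i => measurable_pi_apply _
    have hFs : Measurable (fun η : ℕ → 𝓧 × 𝓨 => F (fun i => η (i + 1))) := hFm.comp hθm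
    rw [e1, lintegral_const_mul _ hFs,
      T_shift_lint hT hmc hst hFm z]
    have e4 : ∀ z', ∫⁻ η, F η ∂(T z') = ∫⁻ x, H (Fin.cons z'.1 x) *
        Bf q κ K N A' (exf (Fin.cons z'.1 x : Fin (N + 1) → 𝓧)) z'.2
        ∂(Measure.pi fun _ : Fin N => μ) := by
      intro z'
      rw [← ih A' hA'm (fun x => H (Fin.cons z'.1 x))
        (hH.comp (measurable_cons measurable_const measurable_id)) z']
      refine lintegral_congr_ae ?_
      filter_upwards [hst z'] with η hη
      simp only [hF, hη]
    have hFT : Measurable fun z' => ∫⁻ η, F η ∂(T z') := hFm.lintegral_kernel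
    rw [lint_kernel hq hκ z hFT]
    have hBm : ∀ y, Measurable (fun x : Fin (N + 1) → 𝓧 => Bf q κ K N A' (exf x) y) := fun y =>
      (measurable_Bf hq K N A' hA'm y).comp measurable_exf
    have hcons : ∀ (a : 𝓧) (n : ℕ), Measurable (fun x : Fin n → 𝓧 => (Fin.cons a x : Fin (n + 1) → 𝓧)) :=
      fun a n => measurable_cons measurable_const measurable_id
    have hHB : Measurable (fun x : Fin (N + 1) → 𝓧 => H x *
        Bf q κ K (N + 1) A (exf (Fin.cons z.1 x : Fin (N + 2) → 𝓧)) z.2) :=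
      hH.mul (((measurable_Bf hq K (N + 1) A hA z.2).comp measurable_exf).comp (hcons z.1 (N + 1)))
    rw [lint_pi_succ hHB]
    have hqm : ∀ j, Measurable (fun a => q (a, j) z) := fun j =>
      hq.comp ((measurable_id.prodMk measurable_const).prodMk measurable_const)
    rw [← lintegral_const_mul]
    swap
    · exact Finset.measurable_sum _ fun j _ => (hqm j).mul
        (hFT.comp (measurable_id.prodMk measurable_const))
    refine lintegral_congr fun a => ?_
    simp only [e4]
    have hHa : Measurable (fun x : Fin N → 𝓧 => H (Fin.cons a x)) :=
      hH.comp (measurable_cons measurable_const measurable_id)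
    have hBa : ∀ j, Measurable (fun x : Fin N → 𝓧 =>
        Bf q κ K N A' (exf (Fin.cons a x : Fin (N + 1) → 𝓧)) j) := fun j =>
      (hBm j).comp (measurable_cons measurable_const measurable_id)
    have hHBa : ∀ j, Measurable (fun x : Fin N → 𝓧 => H (Fin.cons a x) *
        Bf q κ K N A' (exf (Fin.cons a x : Fin (N + 1) → 𝓧)) j) := fun j => hHa.mul (hBa j)
    have hHBq : ∀ j, Measurable (fun x : Fin N → 𝓧 => q (a, j) z * (H (Fin.cons a x) *
        Bf q κ K N A' (exf (Fin.cons a x : Fin (N + 1) → 𝓧)) j)) := fun j => (hHBa j).const_mul _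
    simp_rw [← lintegral_const_mul _ (hHBa _)]
    rw [← lintegral_finsetSum _ (fun j _ => hHBq j), ← lintegral_const_mul _
      (Finset.measurable_sum _ fun j _ => hHBq j)]
    refine lintegral_congr fun x => ?_
    simp only [Function.comp, Bf, exf_cons]
    have e5 : exf (Fin.cons z.1 (Fin.cons a x : Fin (N + 1) → 𝓧) : Fin (N + 2) → 𝓧) 1 = a := by
      have := congrFun (exf_cons z.1 (Fin.cons a x : Fin (N + 1) → 𝓧)) 0
      simpa [exf_zero] using this
    have e6 : exf (Fin.cons z.1 (Fin.cons a x : Fin (N + 1) → 𝓧) : Fin (N + 2) → 𝓧) 0 = z.1 := by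
      rw [exf_zero]; rfl
    rw [e5, e6]
    simp only [Set.indicator]
    by_cases h1 : z ∈ A 0
    · simp only [h1, if_true, Pi.one_apply, one_mul, Finset.mul_sum]
      refine Finset.sum_congr rfl fun j _ => ?_
      ring
    · simp [h1]

end Dens

section PijD

variable {κ : Kernel (𝓧 × 𝓨) (𝓧 × 𝓨)} {q : 𝓧 × 𝓨 → 𝓧 × 𝓨 → ℝ≥0∞} {μ : Measure 𝓧}
  {T : Kernel (𝓧 × 𝓨) (ℕ → 𝓧 × 𝓨)}

theorem pijD_zero (x : Fin (0 + 1) → 𝓧) (i j : 𝓨) : pijD q x i j = if i = j then 1 else 0 := by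
  simp only [pijD, Finset.univ_eq_empty, Finset.prod_empty]
  rw [Fintype.sum_equiv (Equiv.funUnique (Fin 1) 𝓨) _
    (fun a => if a = i ∧ a = j then (1 : ℝ≥0∞) else 0)
    (fun y => by simp [Fin.last])]
  by_cases h : i = j
  · subst h; simp
  · rw [if_neg h]
    refine Finset.sum_eq_zero fun a _ => ?_
    rw [if_neg]
    rintro ⟨rfl, rfl⟩; exact h rfl

theorem pijD_succ {R : ℕ} (x : Fin (R + 1 + 1) → 𝓧) (i j : 𝓨) :
    pijD q x i j = ∑ j', q (x 1, j') (x 0, i) * pijD q (fun k : Fin (R + 1) => x k.succ) j' j := by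
  simp only [pijD, Finset.mul_sum]
  rw [Finset.sum_comm]
  rw [← Fintype.sum_equiv (Fin.consEquiv (fun _ : Fin (R + 2) => 𝓨)) (fun p =>
    if p.1 = i ∧ p.2 (Fin.last R) = j then q (x 1, p.2 0) (x 0, p.1) *
      ∏ k : Fin R, q (x k.succ.succ, p.2 k.succ) (x k.castSucc.succ, p.2 k.castSucc) else 0)]
  · rw [Fintype.sum_prod_type_right]
    refine Finset.sum_congr rfl fun y _ => ?_
    by_cases h : y (Fin.last R) = j
    · simp only [h, and_true, Finset.sum_ite_eq', Finset.mem_univ, if_true]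
      rw [Finset.sum_eq_single (y 0)]
      · simp
      · intro b _ hb
        rw [if_neg (Ne.symm hb), mul_zero]
      · simp
    · simp [h]
  · rintro ⟨a, y⟩
    have h1 : (Fin.last (R + 1)) = Fin.succ (Fin.last R) := rfl
    simp only [Fin.consEquiv_apply, Fin.cons_zero, h1, Fin.cons_succ, Fin.prod_univ_succ,
      Fin.castSucc_zero, Fin.succ_zero_eq_one]
    have h2 : ∀ k : Fin R, (Fin.cons a y : Fin (R + 2) → 𝓨) k.succ.castSucc = y k.castSucc := by
      intro k
      have : k.succ.castSucc = k.castSucc.succ := rfl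
      rw [this, Fin.cons_succ]
    have h3 : (Fin.cons a y : Fin (R + 2) → 𝓨) 1 = y 0 := rfl
    simp only [h2, h3]
    rfl

theorem measurable_pijD (hq : Measurable (Function.uncurry q)) {R : ℕ} (i j : 𝓨) :
    Measurable (fun x : Fin (R + 1) → 𝓧 => pijD q x i j) := by
  unfold pijD
  refine Finset.measurable_sum _ fun y _ => ?_
  split_ifs
  · refine Finset.measurable_prod _ fun k _ => ?_
    have h : Measurable (fun x : Fin (R + 1) → 𝓧 => ((x k.succ, y k.succ), (x k.castSucc, y k.castSucc))) :=
      ((measurable_pi_apply _).prodMk measurable_const).prodMk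
        ((measurable_pi_apply _).prodMk measurable_const)
    exact hq.comp h
  · exact measurable_const

theorem Bf_block (K R N : ℕ) : ∀ (A : ℕ → Set (𝓧 × 𝓨)) (x : ℕ → 𝓧) (i : 𝓨),
    (∀ k < R, A k = Set.univ) → Bf q κ K (N + R) A x i =
      ∑ j, pijD q (fun k : Fin (R + 1) => x k) i j *
        Bf q κ K N (fun k => A (k + R)) (fun k => x (k + R)) j := by
  induction R with
  | zero =>
    intro A x i _
    simp only [pijD_zero, add_zero]
    simp
  | succ R ih =>
    intro A x i hA
    rw [← add_assoc]
    simp only [Bf]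
    rw [hA 0 (by omega), Set.indicator_univ]
    simp only [pijD_succ, Finset.sum_mul]
    rw [Finset.sum_comm]
    refine Finset.sum_congr rfl fun j _ => ?_
    rw [ih (fun i => A (i + 1)) (fun i => x (i + 1)) j (fun k hk => hA (k + 1) (by omega)),
      Finset.mul_sum]
    refine Finset.sum_congr rfl fun j' _ => ?_
    rw [mul_assoc]
    simp only [Fin.val_succ, show ∀ k, k + R + 1 = k + (R + 1) from fun k => by ring]
    rfl

theorem Bf_total (R : ℕ) (x : ℕ → 𝓧) (i : 𝓨) : Bf q κ 0 R (fun _ => Set.univ) x i =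
      ∑ j, pijD q (fun k : Fin (R + 1) => x k) i j := by
  have := Bf_block (q := q) (κ := κ) 0 R 0 (fun _ => Set.univ) x i (fun _ _ => rfl)
  rw [zero_add] at this
  rw [this]
  simp [Bf, Lc]

theorem pijD_congr {q' : 𝓧 × 𝓨 → 𝓧 × 𝓨 → ℝ≥0∞} {R : ℕ} (x : Fin (R + 1) → 𝓧) (i j : 𝓨)
    (h : ∀ (k : Fin R) a b, q (x k.succ, a) (x k.castSucc, b) = q' (x k.succ, a) (x k.castSucc, b)) :
    pijD q x i j = pijD q' x i j := by
  unfold pijD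
  simp only [h]

theorem pijD_ne_top (hq : ∀ z z', q z z' ≠ ∞) {R : ℕ} (x : Fin (R + 1) → 𝓧) (i j : 𝓨) :
    pijD q x i j ≠ ∞ := by
  unfold pijD
  refine (ENNReal.sum_lt_top.2 fun y _ => ?_).ne
  split_ifs
  · exact ENNReal.prod_lt_top fun k _ => (hq _ _).lt_top
  · simp

end PijD

section Good

variable {κ : Kernel (𝓧 × 𝓨) (𝓧 × 𝓨)} {q : 𝓧 × 𝓨 → 𝓧 × 𝓨 → ℝ≥0∞} {μ : Measure 𝓧}
  {T : Kernel (𝓧 × 𝓨) (ℕ → 𝓧 × 𝓨)}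

theorem q_finite_ae [SigmaFinite μ] [IsMarkovKernel κ] (hq : Measurable (Function.uncurry q))
    (hκ : ∀ z, (κ z : Measure (𝓧 × 𝓨)) = (μ.prod Measure.count).withDensity (fun z' => q z' z))
    (z : 𝓧 × 𝓨) : ∀ᵐ z' ∂(μ.prod (Measure.count : Measure 𝓨)), q z' z ≠ ∞ := by
  have hqz : Measurable (fun z' => q z' z) := hq.comp (measurable_id.prodMk measurable_const)
  have h1 : ∫⁻ z', q z' z ∂(μ.prod (Measure.count : Measure 𝓨)) ≠ ∞ := by
    have h2 : κ z Set.univ = 1 := measure_univ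
    rw [hκ, withDensity_apply _ MeasurableSet.univ, Measure.restrict_univ] at h2
    rw [h2]; simp
  filter_upwards [ae_lt_top hqz h1] with z' h using h.ne

theorem q_finite_ae' [SigmaFinite μ] [IsMarkovKernel κ] (hq : Measurable (Function.uncurry q))
    (hκ : ∀ z, (κ z : Measure (𝓧 × 𝓨)) = (μ.prod Measure.count).withDensity (fun z' => q z' z))
    (x : 𝓧) : ∀ᵐ a ∂μ, ∀ i j : 𝓨, q (a, j) (x, i) ≠ ∞ := by
  rw [ae_all_iff]; intro i
  have h := Measure.ae_ae_of_ae_prod (q_finite_ae hq hκ (x, i))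
  filter_upwards [h] with a ha
  intro j
  rw [Measure.ae_count_iff] at ha
  exact ha j

theorem bad_null [SigmaFinite μ] [IsMarkovKernel κ] (hq : Measurable (Function.uncurry q))
    (hκ : ∀ z, (κ z : Measure (𝓧 × 𝓨)) = (μ.prod Measure.count).withDensity (fun z' => q z' z))
    (R : ℕ) : ∀ x0 : 𝓧, ∀ᵐ x ∂(Measure.pi fun _ : Fin R => μ), ∀ (k : Fin R) (i j : 𝓨),
      q ((Fin.cons x0 x : Fin (R + 1) → 𝓧) k.succ, j)
        ((Fin.cons x0 x : Fin (R + 1) → 𝓧) k.castSucc, i) ≠ ∞ := by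
  induction R with
  | zero => intro x0; exact Filter.Eventually.of_forall fun x k => k.elim0
  | succ R ih =>
    intro x0
    set S : Set (Fin (R + 1) → 𝓧) := {x | ∀ (k : Fin (R + 1)) (i j : 𝓨),
      q ((Fin.cons x0 x : Fin (R + 2) → 𝓧) k.succ, j)
        ((Fin.cons x0 x : Fin (R + 2) → 𝓧) k.castSucc, i) ≠ ∞} with hS
    have hcons : Measurable (fun x : Fin (R + 1) → 𝓧 => (Fin.cons x0 x : Fin (R + 2) → 𝓧)) :=
      measurable_cons measurable_const measurable_id
    have hSm : MeasurableSet S := by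
      have : S = ⋂ (k : Fin (R + 1)), ⋂ (i : 𝓨), ⋂ (j : 𝓨),
        {x | q ((Fin.cons x0 x : Fin (R + 2) → 𝓧) k.succ, j)
        ((Fin.cons x0 x : Fin (R + 2) → 𝓧) k.castSucc, i) = ∞}ᶜ := by
        ext x; simp [hS]
      rw [this]
      refine MeasurableSet.iInter fun k => MeasurableSet.iInter fun i =>
        MeasurableSet.iInter fun j => MeasurableSet.compl ?_
      have h1 : Measurable (fun x : Fin (R + 1) → 𝓧 =>
          (((Fin.cons x0 x : Fin (R + 2) → 𝓧) k.succ, j),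
          ((Fin.cons x0 x : Fin (R + 2) → 𝓧) k.castSucc, i))) :=
        (((measurable_pi_apply k.succ).comp hcons).prodMk measurable_const).prodMk
        (((measurable_pi_apply k.castSucc).comp hcons).prodMk measurable_const)
      exact (hq.comp h1) (measurableSet_singleton ∞)
    have key : (Measure.pi fun _ : Fin (R + 1) => μ) Sᶜ = 0 := by
      rw [← lintegral_indicator_one hSm.compl, lint_pi_succ (measurable_one.indicator hSm.compl)]
      refine lintegral_eq_zero_of_ae_eq_zero ?_
      filter_upwards [q_finite_ae' hq hκ x0] with a ha
      refine lintegral_eq_zero_of_ae_eq_zero ?_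
      filter_upwards [ih a] with x hx
      refine Set.indicator_of_notMem ?_ _
      simp only [Set.mem_compl_iff, not_not]
      intro k i j
      refine Fin.cases ?_ (fun k' => ?_) k
      · exact ha i j
      · exact hx k' i j
    exact key

theorem good_blocks [IsMarkovKernel T] [SigmaFinite μ] [IsMarkovKernel κ]
    (hT : IsPathK κ T) (hmc : ∀ z, IsMarkovChain (T z) (fun i (η : ℕ → 𝓧 × 𝓨) => η i) κ)
    (hst : ∀ z, ∀ᵐ η ∂(T z), η 0 = z) (hq : Measurable (Function.uncurry q))
    (hκ : ∀ z, (κ z : Measure (𝓧 × 𝓨)) = (μ.prod Measure.count).withDensity (fun z' => q z' z))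
    {ψ π : Measure (𝓧 × 𝓨)} [IsProbabilityMeasure π] (hπ : IsInvariantMeasure κ π)
    {R : ℕ} {E : Set (Fin (R + 1) → 𝓧)} {Yp : Set (𝓨 × 𝓨)}
    (hA1 : Assumption1 q E Yp) (hA2 : Assumption2 κ ψ μ E Yp) :
    ∃ q' : 𝓧 × 𝓨 → 𝓧 × 𝓨 → ℝ≥0∞, Measurable (Function.uncurry q') ∧ (∀ z z', q' z z' ≠ ∞) ∧
      (∀ z, (κ z : Measure (𝓧 × 𝓨)) = (μ.prod Measure.count).withDensity (fun z' => q' z' z)) ∧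
      ∃ (F : Set (Fin (R + 1) → 𝓧)) (M : ℕ), MeasurableSet F ∧
        (∀ x ∈ F, ∀ i j, ((i, j) ∈ Yp → (M : ℝ≥0∞)⁻¹ ≤ pijD q' x i j ∧ pijD q' x i j ≤ M) ∧
          ((i, j) ∉ Yp → pijD q' x i j = 0)) ∧
        0 < ∫⁻ z, T z {η | (fun k : Fin (R + 1) => (η k).1) ∈ F} ∂π := by
  classical
  set q' : 𝓧 × 𝓨 → 𝓧 × 𝓨 → ℝ≥0∞ := fun z' z => if q z' z = ∞ then 0 else q z' z with hq'
  have hq'm : Measurable (Function.uncurry q') :=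
    Measurable.ite (hq (measurableSet_singleton ∞)) measurable_const hq
  have hq'f : ∀ z z', q' z z' ≠ ∞ := by
    intro z z'; simp only [hq']; split_ifs with h
    · simp
    · exact h
  have hq'κ : ∀ z, (κ z : Measure (𝓧 × 𝓨)) =
      (μ.prod Measure.count).withDensity (fun z' => q' z' z) := by
    intro z
    rw [hκ]
    refine withDensity_congr_ae ?_
    filter_upwards [q_finite_ae hq hκ z] with z' h
    simp [hq', h]
  refine ⟨q', hq'm, hq'f, hq'κ, ?_⟩
  obtain ⟨hR, hYne, hEY, hYprod⟩ := hA1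
  obtain ⟨⟨_, hψirr, _⟩, hψE, hsec⟩ := hA2
  set E' : Set (Fin (R + 1) → 𝓧) := {x | ∀ i j, (i, j) ∈ Yp ↔ 0 < pijD q' x i j} with hE'
  have hE'm : MeasurableSet E' := by
    have : E' = ⋂ i, ⋂ j, {x | (i, j) ∈ Yp ↔ 0 < pijD q' x i j} := by ext; simp [hE']
    rw [this]
    refine MeasurableSet.iInter fun i => MeasurableSet.iInter fun j => ?_
    have h0 : MeasurableSet {x : Fin (R + 1) → 𝓧 | 0 < pijD q' x i j} :=
      measurableSet_lt measurable_const (measurable_pijD hq'm i j)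
    by_cases h : (i, j) ∈ Yp
    · have e : {x : Fin (R + 1) → 𝓧 | (i, j) ∈ Yp ↔ 0 < pijD q' x i j} =
          {x | 0 < pijD q' x i j} := by ext x; simp only [Set.mem_ofPred_eq, h, true_iff]
      rw [e]; exact h0
    · have e : {x : Fin (R + 1) → 𝓧 | (i, j) ∈ Yp ↔ 0 < pijD q' x i j} =
          {x | 0 < pijD q' x i j}ᶜ := by
        ext x; simp only [Set.mem_ofPred_eq, h, false_iff, Set.mem_compl_iff]
      rw [e]; exact h0.compl
  have hXm : Measurable (fun (η : ℕ → 𝓧 × 𝓨) (k : Fin (R + 1)) => (η k).1) :=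
    measurable_pi_lambda _ fun i => measurable_fst.comp (measurable_pi_apply _)
  have hcons : ∀ a : 𝓧, Measurable (fun x : Fin R → 𝓧 => (Fin.cons a x : Fin (R + 1) → 𝓧)) :=
    fun a => measurable_cons measurable_const measurable_id
  have hdens : ∀ z, T z {η | (fun k : Fin (R + 1) => (η k).1) ∈ E'} =
      ∫⁻ x, E'.indicator 1 (Fin.cons z.1 x : Fin (R + 1) → 𝓧) *
        ∑ j, pijD q' (Fin.cons z.1 x : Fin (R + 1) → 𝓧) z.2 j ∂(Measure.pi fun _ : Fin R => μ) := by
    intro z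
    have h := density hT hmc hst hq'm hq'κ 0 R (fun _ => Set.univ) (fun _ => MeasurableSet.univ)
      (fun x => E'.indicator 1 (Fin.cons z.1 x : Fin (R + 1) → 𝓧))
      ((measurable_one.indicator hE'm).comp (hcons z.1)) z
    have h2 : ∀ x : Fin R → 𝓧, Bf q' κ 0 R (fun _ => Set.univ)
        (exf (Fin.cons z.1 x : Fin (R + 1) → 𝓧)) z.2 =
        ∑ j, pijD q' (Fin.cons z.1 x : Fin (R + 1) → 𝓧) z.2 j := by
      intro x
      rw [Bf_total]
      have : (fun k : Fin (R + 1) => exf (Fin.cons z.1 x : Fin (R + 1) → 𝓧) k) = Fin.cons z.1 x := by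
        funext k
        rw [exf_apply _ _ (by omega)]
      rw [this]
    simp only [h2] at h
    have hm0 : MeasurableSet {η : ℕ → 𝓧 × 𝓨 | (fun k : Fin (R + 1) => (η k).1) ∈ E'} := hXm hE'm
    rw [← h, ← lintegral_indicator_one hm0]
    refine lintegral_congr_ae ?_
    filter_upwards [hst z] with η hη
    have h3 : (Fin.cons z.1 (fun i : Fin R => (η (i + 1)).1) : Fin (R + 1) → 𝓧) =
        fun k : Fin (R + 1) => (η k).1 := by
      funext k
      refine Fin.cases ?_ (fun k' => ?_) k
      · simp [hη]
      · simp
    rw [h3]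
    simp [Set.indicator]
  set B : Set (𝓧 × 𝓨) := {z | 0 < T z {η | (fun k : Fin (R + 1) => (η k).1) ∈ E'}} with hB
  have hBm : MeasurableSet B := measurableSet_lt measurable_const (T.measurable_coe (hXm hE'm))
  have hsub : proj1 E ×ˢ (Prod.fst '' Yp) ⊆ B := by
    rintro ⟨x1, i⟩ ⟨hx1, hi⟩
    simp only at hx1 hi
    obtain ⟨⟨i', j⟩, hij, rfl⟩ := hi
    by_contra hcon
    have hz : T (x1, i') {η | (fun k : Fin (R + 1) => (η k).1) ∈ E'} = 0 :=
      nonpos_iff_eq_zero.1 (not_lt.1 hcon)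
    rw [hdens] at hz
    rw [lintegral_eq_zero_iff] at hz
    swap
    · refine Measurable.mul ((measurable_one.indicator hE'm).comp (hcons x1)) ?_
      exact Finset.measurable_sum _ fun j _ => (measurable_pijD hq'm i' j).comp (hcons x1)
    have h4 : ∀ᵐ x ∂(Measure.pi fun _ : Fin R => μ), x ∉ secSet E x1 := by
      filter_upwards [hz, bad_null hq hκ R x1] with x hx hbad hxE
      have hY := hEY _ hxE
      have hpq : ∀ a b, pijD q (Fin.cons x1 x : Fin (R + 1) → 𝓧) a b =
          pijD q' (Fin.cons x1 x : Fin (R + 1) → 𝓧) a b := by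
        intro a b
        refine pijD_congr _ _ _ fun k a b => ?_
        simp only [hq']
        rw [if_neg (hbad k b a)]
      have hmem : (Fin.cons x1 x : Fin (R + 1) → 𝓧) ∈ E' := by
        intro a b
        rw [← hpq, ← hY]; rfl
      simp only [Set.indicator_of_mem hmem, Pi.one_apply, one_mul, Pi.zero_apply] at hx
      rw [Finset.sum_eq_zero_iff] at hx
      exact ((hmem i' j).1 hij).ne' (hx j (Finset.mem_univ _))
    have h5 : (Measure.pi fun _ : Fin R => μ) (secSet E x1) = 0 := by
      rw [ae_iff] at h4; simpa using h4
    exact (hsec x1 hx1).ne' h5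
  have hψB : 0 < ψ B := hψE.trans_le (measure_mono hsub)
  have hπB : 0 < π B := pi_pos hπ hψirr hBm hψB
  set F : ℕ → Set (Fin (R + 1) → 𝓧) := fun M => E' ∩ ⋂ i, ⋂ j, {x | (i, j) ∈ Yp →
    (M : ℝ≥0∞)⁻¹ ≤ pijD q' x i j ∧ pijD q' x i j ≤ M} with hF
  have hFm : ∀ M, MeasurableSet (F M) := by
    intro M
    refine hE'm.inter (MeasurableSet.iInter fun i => MeasurableSet.iInter fun j => ?_)
    by_cases h : (i, j) ∈ Yp
    · simp only [h, forall_const]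
      exact (measurableSet_le measurable_const (measurable_pijD hq'm i j)).inter
        (measurableSet_le (measurable_pijD hq'm i j) measurable_const)
    · simp [h]
  have hFu : E' ⊆ ⋃ M, F M := by
    intro x hx
    have h1 : ∀ p : 𝓨 × 𝓨, ∃ M : ℕ, p ∈ Yp →
        (M : ℝ≥0∞)⁻¹ ≤ pijD q' x p.1 p.2 ∧ pijD q' x p.1 p.2 ≤ M := by
      intro p
      by_cases hp : p ∈ Yp
      · obtain ⟨M1, hM1⟩ := ENNReal.exists_nat_gt (pijD_ne_top hq'f x p.1 p.2)
        obtain ⟨M2, hM2⟩ := ENNReal.exists_inv_nat_lt ((hx p.1 p.2).1 hp).ne'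
        refine ⟨max M1 M2, fun _ => ⟨le_trans ?_ hM2.le, hM1.le.trans ?_⟩⟩
        · exact ENNReal.inv_le_inv.2 (by exact_mod_cast le_max_right _ _)
        · exact_mod_cast le_max_left _ _
      · exact ⟨0, fun h => absurd h hp⟩
    choose m hm using h1
    refine Set.mem_iUnion.2 ⟨Finset.univ.sup m, hx, ?_⟩
    simp only [Set.mem_iInter, Set.mem_ofPred_eq]
    intro i j hij
    have h2 : m (i, j) ≤ Finset.univ.sup m := Finset.le_sup (Finset.mem_univ _)
    have h3 := hm (i, j) hij
    refine ⟨le_trans ?_ h3.1, h3.2.trans ?_⟩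
    · exact ENNReal.inv_le_inv.2 (by exact_mod_cast h2)
    · exact_mod_cast h2
  have hex : ∃ M, 0 < ∫⁻ z, T z {η | (fun k : Fin (R + 1) => (η k).1) ∈ F M} ∂π := by
    by_contra hcon
    push Not at hcon
    have h1 : ∀ M, ∀ᵐ z ∂π, T z {η | (fun k : Fin (R + 1) => (η k).1) ∈ F M} = 0 := by
      intro M
      have := nonpos_iff_eq_zero.1 (hcon M)
      have hm0 : MeasurableSet {η : ℕ → 𝓧 × 𝓨 | (fun k : Fin (R + 1) => (η k).1) ∈ F M} :=
        hXm (hFm M)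
      rwa [lintegral_eq_zero_iff (T.measurable_coe hm0)] at this
    have h2 : ∀ᵐ z ∂π, z ∉ B := by
      filter_upwards [ae_all_iff.2 h1] with z hz hzB
      have h3 : T z {η | (fun k : Fin (R + 1) => (η k).1) ∈ E'} ≤
          T z (⋃ M, {η | (fun k : Fin (R + 1) => (η k).1) ∈ F M}) := by
        refine measure_mono fun η hη => ?_
        obtain ⟨M, hM⟩ := Set.mem_iUnion.1 (hFu hη)
        exact Set.mem_iUnion.2 ⟨M, hM⟩
      rw [measure_iUnion_null hz] at h3
      exact absurd hzB (not_lt.2 h3)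
    have h5 : π B = 0 := by rw [ae_iff] at h2; simpa using h2
    exact hπB.ne' h5
  obtain ⟨M, hM⟩ := hex
  refine ⟨F M, M, hFm M, ?_, hM⟩
  intro x hx i j
  refine ⟨fun hij => ?_, fun hij => ?_⟩
  · have := hx.2
    simp only [Set.mem_iInter, Set.mem_ofPred_eq] at this
    exact this i j hij
  · by_contra h
    exact hij ((hx.1 i j).2 (pos_iff_ne_zero.2 h))

end Good

section Contract

/-- Oscillation bound. -/
def OscB (B b : 𝓨 → ℝ) (d : ℝ) : Prop :=
  ∃ lo hi : ℝ, lo ≤ hi ∧ hi - lo ≤ d ∧ ∀ i, lo * b i ≤ B i ∧ B i ≤ hi * b i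

theorem osc_step {B b B' b' : 𝓨 → ℝ} {d : ℝ} (p : 𝓨 → 𝓨 → ℝ) (hp : ∀ i j, 0 ≤ p i j)
    (hB : ∀ i, B' i = ∑ j, p i j * B j) (hb : ∀ i, b' i = ∑ j, p i j * b j)
    (h : OscB B b d) : OscB B' b' d := by
  obtain ⟨lo, hi, h1, h2, h3⟩ := h
  refine ⟨lo, hi, h1, h2, fun i => ⟨?_, ?_⟩⟩
  · rw [hB, hb, Finset.mul_sum]
    refine Finset.sum_le_sum fun j _ => ?_
    have := mul_le_mul_of_nonneg_left (h3 j).1 (hp i j)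
    linarith
  · rw [hB, hb, Finset.mul_sum]
    refine Finset.sum_le_sum fun j _ => ?_
    have := mul_le_mul_of_nonneg_left (h3 j).2 (hp i j)
    linarith

theorem osc_good {B b B' b' : 𝓨 → ℝ} {d δ a c : ℝ} (p : 𝓨 → 𝓨 → ℝ) (Y1 Y2 : Finset 𝓨)
    (hb0 : ∀ j, 0 ≤ b j) (ha : 0 ≤ a) (hδ : 0 ≤ δ) (hδ1 : δ ≤ 1) (hδc : δ * c ≤ a)
    (hp1 : ∀ i ∈ Y1, ∀ j ∈ Y2, a ≤ p i j ∧ p i j ≤ c)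
    (hp0 : ∀ i j, ¬ (i ∈ Y1 ∧ j ∈ Y2) → p i j = 0)
    (hB : ∀ i, B' i = ∑ j, p i j * B j) (hb : ∀ i, b' i = ∑ j, p i j * b j)
    (h : OscB B b d) : OscB B' b' ((1 - δ) * d) := by
  obtain ⟨lo, hi, h1, h2, h3⟩ := h
  have hred : ∀ f : 𝓨 → ℝ, ∀ i, ∑ j, p i j * f j = ∑ j ∈ Y2, p i j * f j := by
    intro f i
    refine (Finset.sum_subset (Finset.subset_univ _) fun j _ hj => ?_).symm
    rw [hp0 i j (fun h => hj h.2), zero_mul]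
  have hout : ∀ f : 𝓨 → ℝ, ∀ i, i ∉ Y1 → ∑ j, p i j * f j = 0 := by
    intro f i hi
    refine Finset.sum_eq_zero fun j _ => ?_
    rw [hp0 i j (fun h => hi h.1), zero_mul]
  set S := ∑ j ∈ Y2, b j with hS
  set U := ∑ j ∈ Y2, B j with hU
  have hS0 : 0 ≤ S := Finset.sum_nonneg fun j _ => hb0 j
  have hd : 0 ≤ d := by linarith
  have hlo : lo * S ≤ U := by
    rw [hS, Finset.mul_sum]; exact Finset.sum_le_sum fun j _ => (h3 j).1
  have hhi : U ≤ hi * S := by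
    rw [hS, Finset.mul_sum]; exact Finset.sum_le_sum fun j _ => (h3 j).2
  have hbS : ∀ i ∈ Y1, b' i ≤ c * S := by
    intro i hi
    rw [hb, hred, hS, Finset.mul_sum]
    exact Finset.sum_le_sum fun j hj => mul_le_mul_of_nonneg_right (hp1 i hi j hj).2 (hb0 j)
  have hb'0 : ∀ i ∈ Y1, 0 ≤ b' i := by
    intro i hi
    rw [hb, hred]
    exact Finset.sum_nonneg fun j hj => mul_nonneg (ha.trans (hp1 i hi j hj).1) (hb0 j)
  have hl : ∀ i ∈ Y1, a * (U - lo * S) ≤ B' i - lo * b' i := by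
    intro i hi
    rw [hB, hb, hred, hred, hS, hU, Finset.mul_sum, ← Finset.sum_sub_distrib, Finset.mul_sum,
      Finset.mul_sum, ← Finset.sum_sub_distrib]
    refine Finset.sum_le_sum fun j hj => ?_
    have := mul_le_mul_of_nonneg_right (hp1 i hi j hj).1 (sub_nonneg.2 (h3 j).1)
    linarith
  have hh : ∀ i ∈ Y1, a * (hi * S - U) ≤ hi * b' i - B' i := by
    intro i hi'
    rw [hB, hb, hred, hred, hS, hU, Finset.mul_sum, ← Finset.sum_sub_distrib, Finset.mul_sum,
      Finset.mul_sum, ← Finset.sum_sub_distrib]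
    refine Finset.sum_le_sum fun j hj => ?_
    have := mul_le_mul_of_nonneg_right (hp1 i hi' j hj).1 (sub_nonneg.2 (h3 j).2)
    linarith
  rcases hS0.eq_or_lt with hSz | hSp
  · have hbz : ∀ j ∈ Y2, b j = 0 := (Finset.sum_eq_zero_iff_of_nonneg fun j _ => hb0 j).1 hSz.symm
    have hBz : ∀ j ∈ Y2, B j = 0 := by
      intro j hj
      have := h3 j
      rw [hbz j hj] at this
      linarith [this.1, this.2]
    refine ⟨0, 0, le_rfl, ?_, fun i => ?_⟩
    · rw [sub_zero]; exact mul_nonneg (by linarith) hd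
    · have : B' i = 0 := by
        rw [hB, hred]; exact Finset.sum_eq_zero fun j hj => by rw [hBz j hj, mul_zero]
      simp [this]
  · set θ := U / S with hθ
    have hUθ : U = θ * S := by rw [hθ]; field_simp
    have hθ1 : lo ≤ θ := by rw [hθ, le_div_iff₀ hSp]; exact hlo
    have hθ2 : θ ≤ hi := by rw [hθ, div_le_iff₀ hSp]; exact hhi
    have hδb : ∀ i ∈ Y1, δ * b' i ≤ a * S := by
      intro i hi'
      calc δ * b' i ≤ δ * (c * S) := mul_le_mul_of_nonneg_left (hbS i hi') hδ
        _ = (δ * c) * S := by ring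
        _ ≤ a * S := mul_le_mul_of_nonneg_right hδc hS0
    refine ⟨lo + δ * (θ - lo), hi - δ * (hi - θ), ?_, ?_, fun i => ?_⟩
    · nlinarith
    · nlinarith
    · by_cases hi' : i ∈ Y1
      · constructor
        · have e1 := hl i hi'
          have e2 := mul_le_mul_of_nonneg_right (hδb i hi') (sub_nonneg.2 hθ1)
          rw [hUθ] at e1
          nlinarith
        · have e1 := hh i hi'
          have e2 := mul_le_mul_of_nonneg_right (hδb i hi') (sub_nonneg.2 hθ2)
          rw [hUθ] at e1
          nlinarith
      · rw [hB, hb, hout _ _ hi', hout _ _ hi']; simp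

open Classical in
theorem osc_count (Osc : ℕ → ℕ → Prop) (good : ℕ → Prop) (R T : ℕ) (hR : 1 ≤ R)
    (h0 : Osc T 0) (hstep : ∀ k e, k < T → Osc (k + 1) e → Osc k e)
    (hgood : ∀ k e, k + R ≤ T → good k → Osc (k + R) e → Osc k (e + 1)) (d : ℕ) :
    ∀ k, k ≤ T → T - k = d →
      ∃ e, Osc k e ∧ ((Finset.Ico k (T + 1 - R)).filter good).card ≤ R * e := by
  have hz : ∀ d k, k ≤ T → T - k = d → Osc k 0 := by
    intro d; induction d with
    | zero => intro k hk h; have : k = T := by omega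
              rw [this]; exact h0
    | succ d ih => intro k hk h; exact hstep k 0 (by omega) (ih (k + 1) (by omega) (by omega))
  induction d using Nat.strong_induction_on with
  | _ d ih =>
    intro k hk hd
    by_cases hkR : k + R ≤ T
    · by_cases hg : good k
      · obtain ⟨e, he, hc⟩ := ih (T - (k + R)) (by omega) (k + R) hkR rfl
        refine ⟨e + 1, hgood k e hkR hg he, ?_⟩
        have hsub : (Finset.Ico k (T + 1 - R)).filter good ⊆
            Finset.Ico k (k + R) ∪ (Finset.Ico (k + R) (T + 1 - R)).filter good := by
          intro i hi
          simp only [Finset.mem_filter, Finset.mem_Ico, Finset.mem_union] at *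
          by_cases h : i < k + R
          · left; omega
          · right; exact ⟨by omega, hi.2⟩
        have h1 := Finset.card_le_card hsub
        have h2 := Finset.card_union_le (Finset.Ico k (k + R))
          ((Finset.Ico (k + R) (T + 1 - R)).filter good)
        have h3 : (Finset.Ico k (k + R)).card = R := by simp
        rw [mul_add]
        omega
      · obtain ⟨e, he, hc⟩ := ih (T - (k + 1)) (by omega) (k + 1) (by omega) rfl
        refine ⟨e, hstep k e (by omega) he, ?_⟩
        refine le_trans (Finset.card_le_card ?_) hc
        intro i hi
        simp only [Finset.mem_filter, Finset.mem_Ico] at *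
        refine ⟨⟨?_, hi.1.2⟩, hi.2⟩
        rcases eq_or_lt_of_le hi.1.1 with h | h
        · exact absurd (h ▸ hi.2) hg
        · exact h
    · refine ⟨0, hz _ k hk rfl, ?_⟩
      rw [Finset.Ico_eq_empty (by omega)]
      simp

end Contract

section Pointwise

variable {q : 𝓧 × 𝓨 → 𝓧 × 𝓨 → ℝ≥0∞} {κ : Kernel (𝓧 × 𝓨) (𝓧 × 𝓨)}

/-- Number of good blocks. -/
noncomputable def gcount {R : ℕ} (F : Set (Fin (R + 1) → 𝓧)) (n : ℕ) (x : ℕ → 𝓧) : ℝ :=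
  ∑ k ∈ Finset.range n, F.indicator (fun _ => (1 : ℝ)) (fun h : Fin (R + 1) => x (k + h))

theorem measurable_gcount {R : ℕ} {F : Set (Fin (R + 1) → 𝓧)} (hF : MeasurableSet F) (n : ℕ) :
    Measurable (gcount F n) := by
  unfold gcount
  refine Finset.measurable_sum _ fun k _ => ?_
  exact (measurable_const.indicator hF).comp
    (measurable_pi_lambda _ fun h => measurable_pi_apply (X := fun _ : ℕ => 𝓧) _)

theorem gcount_congr {R : ℕ} (F : Set (Fin (R + 1) → 𝓧)) (T : ℕ) (x x' : ℕ → 𝓧)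
    (h : ∀ i ≤ T, x i = x' i) : gcount F (T + 1 - R) x = gcount F (T + 1 - R) x' := by
  unfold gcount
  refine Finset.sum_congr rfl fun k hk => ?_
  rw [Finset.mem_range] at hk
  have : (fun h : Fin (R + 1) => x (k + h)) = (fun h : Fin (R + 1) => x' (k + h)) := by
    ext i; exact h _ (by omega)
  rw [this]

/-- Sum of backward functions. -/
noncomputable def SB {ι : Type*} (q : 𝓧 × 𝓨 → 𝓧 × 𝓨 → ℝ≥0∞) (κ : Kernel (𝓧 × 𝓨) (𝓧 × 𝓨))
    (K N : ℕ) (A : ι → ℕ → Set (𝓧 × 𝓨)) (V : Finset ι) (x : ℕ → 𝓧) (k : ℕ) (i : 𝓨) : ℝ≥0∞ :=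
  ∑ v ∈ V, Bf q κ K (N - k) (fun j => A v (j + k)) (fun j => x (j + k)) i

theorem SB_ne_top {ι : Type*} [IsMarkovKernel κ] (hqf : ∀ z z', q z z' ≠ ∞)
    (K N : ℕ) (A : ι → ℕ → Set (𝓧 × 𝓨)) (V : Finset ι) (x : ℕ → 𝓧) (k : ℕ) (i : 𝓨) :
    SB q κ K N A V x k i ≠ ∞ :=
  (ENNReal.sum_lt_top.2 fun _ _ => (Bf_ne_top hqf _ _ _ _ _).lt_top).ne

theorem SB_block {ι : Type*} [IsMarkovKernel κ] (hqf : ∀ z z', q z z' ≠ ∞)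
    (K N T : ℕ) (hTN : T ≤ N) (A : ι → ℕ → Set (𝓧 × 𝓨)) (hA : ∀ v, ∀ k < T, A v k = Set.univ)
    (V : Finset ι) (x : ℕ → 𝓧) (k r : ℕ) (hk : k + r ≤ T) (i : 𝓨) :
    (SB q κ K N A V x k i).toReal =
      ∑ j, (pijD q (fun h : Fin (r + 1) => x (k + h)) i j).toReal *
        (SB q κ K N A V x (k + r) j).toReal := by
  have h1 : SB q κ K N A V x k i = ∑ j, pijD q (fun h : Fin (r + 1) => x (k + h)) i j *
        SB q κ K N A V x (k + r) j := by
    unfold SB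
    simp_rw [Finset.mul_sum]
    rw [Finset.sum_comm]
    refine Finset.sum_congr rfl fun v _ => ?_
    have hN : N - k = (N - (k + r)) + r := by omega
    rw [hN, Bf_block _ _ _ _ _ _ (fun j hj => hA v _ (by omega))]
    have e1 : (fun j => A v (j + r + k)) = fun j => A v (j + (k + r)) := by
      ext j : 1; congr 1; omega
    have e2 : (fun j => x (j + r + k)) = fun j => x (j + (k + r)) := by
      ext j : 1; congr 1; omega
    have e3 : (fun h : Fin (r + 1) => x (h + k)) = fun h : Fin (r + 1) => x (k + h) := by
      ext j : 1; congr 1; omega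
    rw [e1, e2, e3]
  rw [h1, ENNReal.toReal_sum]
  · simp_rw [ENNReal.toReal_mul]
  · intro j _
    exact ENNReal.mul_ne_top (pijD_ne_top hqf _ _ _) (SB_ne_top hqf _ _ _ _ _ _ _)

theorem SB_osc {ι : Type*} [Fintype ι] [IsMarkovKernel κ] (hqf : ∀ z z', q z z' ≠ ∞)
    {R : ℕ} (hR : 1 ≤ R) {F : Set (Fin (R + 1) → 𝓧)} {Yp : Set (𝓨 × 𝓨)}
    (hYp : Yp = (Prod.fst '' Yp) ×ˢ (Prod.snd '' Yp)) {M : ℕ}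
    (hF : ∀ x ∈ F, ∀ i j, ((i, j) ∈ Yp → (M : ℝ≥0∞)⁻¹ ≤ pijD q x i j ∧ pijD q x i j ≤ M) ∧
      ((i, j) ∉ Yp → pijD q x i j = 0)) {ρ : ℝ} (hρ : ρ = 1 - 1 / (2 * ((M : ℝ) + 1) ^ 2))
    (K N T : ℕ) (hTN : T ≤ N) (A : ι → ℕ → Set (𝓧 × 𝓨)) (hA : ∀ v, ∀ k < T, A v k = Set.univ)
    (V : Finset ι) (x : ℕ → 𝓧) :
    OscB (fun i => (SB q κ K N A V x 0 i).toReal)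
      (fun i => (SB q κ K N A Finset.univ x 0 i).toReal) (ρ ^ (gcount F (T + 1 - R) x / R)) := by
  classical
  have hM0 : (0 : ℝ) ≤ M := Nat.cast_nonneg M
  have hδ1 : 1 / (2 * ((M : ℝ) + 1) ^ 2) ≤ 1 / 2 := by
    apply one_div_le_one_div_of_le (by norm_num)
    nlinarith
  have hδ0 : 0 < 1 / (2 * ((M : ℝ) + 1) ^ 2) := by positivity
  have hρ0 : 0 < ρ := by linarith
  have hρ1 : ρ ≤ 1 := by linarith
  have h0 : OscB (fun i => (SB q κ K N A V x T i).toReal)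
      (fun i => (SB q κ K N A Finset.univ x T i).toReal) (ρ ^ 0) := by
    refine ⟨0, 1, zero_le_one, by simp, fun i => ?_⟩
    simp only [zero_mul, one_mul]
    refine ⟨ENNReal.toReal_nonneg, ENNReal.toReal_mono (SB_ne_top hqf _ _ _ _ _ _ _) ?_⟩
    exact Finset.sum_le_sum_of_subset (Finset.subset_univ _)
  have hs : ∀ k e : ℕ, k < T → OscB (fun i => (SB q κ K N A V x (k+1) i).toReal)
      (fun i => (SB q κ K N A Finset.univ x (k+1) i).toReal) (ρ ^ (e)) →
      OscB (fun i => (SB q κ K N A V x (k) i).toReal)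
      (fun i => (SB q κ K N A Finset.univ x (k) i).toReal) (ρ ^ (e)) := by
    intro k e hk h
    exact osc_step (fun i j => (pijD q (fun h : Fin (1 + 1) => x (k + h)) i j).toReal)
      (fun i j => ENNReal.toReal_nonneg)
      (fun i => SB_block hqf K N T hTN A hA V x k 1 (by omega) i)
      (fun i => SB_block hqf K N T hTN A hA Finset.univ x k 1 (by omega) i) h
  have hgd : ∀ k e : ℕ, k + R ≤ T → (fun h : Fin (R + 1) => x (k + h)) ∈ F →
      OscB (fun i => (SB q κ K N A V x (k+R) i).toReal)
      (fun i => (SB q κ K N A Finset.univ x (k+R) i).toReal) (ρ ^ (e)) →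
      OscB (fun i => (SB q κ K N A V x (k) i).toReal)
      (fun i => (SB q κ K N A Finset.univ x (k) i).toReal) (ρ ^ (e+1)) := by
    intro k e hk hg h
    have := osc_good (a := ((M : ℝ) + 1)⁻¹) (c := (M : ℝ) + 1)
      (δ := 1 / (2 * ((M : ℝ) + 1) ^ 2))
      (fun i j => (pijD q (fun h : Fin (R + 1) => x (k + h)) i j).toReal)
      (Finset.univ.filter (· ∈ Prod.fst '' Yp)) (Finset.univ.filter (· ∈ Prod.snd '' Yp))
      (fun j => ENNReal.toReal_nonneg) (by positivity) hδ0.le (by linarith) ?_ ?_ ?_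
      (fun i => SB_block hqf K N T hTN A hA V x k R hk i)
      (fun i => SB_block hqf K N T hTN A hA Finset.univ x k R hk i) h
    · rw [← hρ, mul_comm, ← pow_succ] at this
      exact this
    · rw [div_mul_eq_mul_div, one_mul, div_le_iff₀ (by positivity)]
      rw [sq]; field_simp; norm_num
    · intro i hi j hj
      have hij : (i, j) ∈ Yp := by
        rw [hYp]; exact ⟨(Finset.mem_filter.1 hi).2, (Finset.mem_filter.1 hj).2⟩
      obtain ⟨h1, h2⟩ := ((hF _ hg i j).1 hij)
      have hM : (0 : ℝ) < M := by
        rcases Nat.eq_zero_or_pos M with h | h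
        · subst h
          simp at h1 h2
          rw [h2] at h1; simp at h1
        · exact_mod_cast h
      have h1' := ENNReal.toReal_mono (pijD_ne_top hqf _ _ _) h1
      have h2' := ENNReal.toReal_mono (by simp) h2
      simp only [ENNReal.toReal_inv, ENNReal.toReal_natCast] at h1' h2'
      refine ⟨le_trans ?_ h1', by linarith⟩
      exact inv_anti₀ hM (by linarith)
    · intro i j hij
      have : (i, j) ∉ Yp := by
        intro h
        apply hij
        simp only [Finset.mem_filter, Finset.mem_univ, true_and]
        exact ⟨⟨_, h, rfl⟩, ⟨_, h, rfl⟩⟩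
      simp only [(hF _ hg i j).2 this, ENNReal.toReal_zero]
  obtain ⟨e, he, hc⟩ := osc_count
    (fun k e => OscB (fun i => (SB q κ K N A V x k i).toReal)
      (fun i => (SB q κ K N A Finset.univ x k i).toReal) (ρ ^ e))
    (fun k => (fun h : Fin (R + 1) => x (k + h)) ∈ F) R T hR h0 hs hgd T 0 (Nat.zero_le _) rfl
  · obtain ⟨lo, hi, h1, h2, h3⟩ := he
    refine ⟨lo, hi, h1, h2.trans ?_, h3⟩
    rw [← Real.rpow_natCast]
    apply Real.rpow_le_rpow_of_exponent_ge hρ0 hρ1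
    have hg : gcount F (T + 1 - R) x = (((Finset.Ico 0 (T + 1 - R)).filter
        (fun k => (fun h : Fin (R + 1) => x (k + h)) ∈ F)).card : ℝ) := by
      unfold gcount
      rw [Finset.card_filter, Nat.cast_sum, Finset.range_eq_Ico]
      refine Finset.sum_congr rfl fun k _ => ?_
      by_cases h : (fun h : Fin (R + 1) => x (k + h)) ∈ F <;> simp [h]
    rw [hg]
    have hR' : (0 : ℝ) < R := by exact_mod_cast hR
    rw [div_le_iff₀ hR', mul_comm]
    exact_mod_cast hc

open Classical in
/-- lower ratio -/
noncomputable def loE (B b : 𝓨 → ℝ≥0∞) : ℝ≥0∞ := ⨅ y, if b y = 0 then 1 else B y / b y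

theorem measurable_loE {α : Type*} [MeasurableSpace α] {B b : α → 𝓨 → ℝ≥0∞}
    (hB : ∀ y, Measurable fun a => B a y) (hb : ∀ y, Measurable fun a => b a y) :
    Measurable fun a => loE (B a) (b a) := by
  unfold loE
  refine Measurable.iInf fun y => ?_
  refine Measurable.ite ?_ measurable_const ((hB y).div (hb y))
  exact hb y (measurableSet_singleton 0)

theorem loE_spec (B b : 𝓨 → ℝ≥0∞) (hBb : ∀ y, B y ≤ b y) (hb : ∀ y, b y ≠ ∞) {d : ℝ}
    (h : OscB (fun y => (B y).toReal) (fun y => (b y).toReal) d) :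
    loE B b ≤ 1 ∧ ∀ y, loE B b * b y ≤ B y ∧ B y ≤ (loE B b + ENNReal.ofReal d) * b y := by
  obtain ⟨lo, hi, h1, h2, h3⟩ := h
  have hd : 0 ≤ d := by linarith
  have hB : ∀ y, B y ≠ ∞ := fun y => ne_top_of_le_ne_top (hb y) (hBb y)
  have hdiv : ∀ y, B y / b y ≤ 1 := fun y => ENNReal.div_le_of_le_mul (by simpa using hBb y)
  refine ⟨?_, fun y => ⟨?_, ?_⟩⟩
  · refine (iInf_le _ (Classical.arbitrary 𝓨)).trans ?_
    split_ifs
    · exact le_rfl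
    · exact hdiv _
  · by_cases h0 : b y = 0
    · simp [h0]
    · have : loE B b ≤ B y / b y := (iInf_le _ y).trans (by rw [if_neg h0])
      calc loE B b * b y ≤ B y / b y * b y := by gcongr
        _ = B y := ENNReal.div_mul_cancel h0 (hb y)
  · by_cases h0 : b y = 0
    · rw [h0, mul_zero, ← h0]; exact hBb y
    · have key : B y / b y ≤ loE B b + ENNReal.ofReal d := by
        unfold loE
        rw [ENNReal.iInf_add]
        refine le_iInf fun y0 => ?_
        split_ifs with h0'
        · exact (hdiv y).trans le_self_add
        · have hp : 0 < (b y).toReal := ENNReal.toReal_pos h0 (hb y)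
          have hp0 : 0 < (b y0).toReal := ENNReal.toReal_pos h0' (hb y0)
          have hne : ∀ y, b y ≠ 0 → B y / b y ≠ ∞ := fun y h => ENNReal.div_ne_top (hB y) h
          rw [← ENNReal.toReal_le_toReal (hne y h0)
            (ENNReal.add_ne_top.2 ⟨hne y0 h0', ENNReal.ofReal_ne_top⟩),
            ENNReal.toReal_add (hne y0 h0') ENNReal.ofReal_ne_top, ENNReal.toReal_ofReal hd,
            ENNReal.toReal_div, ENNReal.toReal_div]
          have e1 : (B y).toReal / (b y).toReal ≤ hi := (div_le_iff₀ hp).2 (h3 y).2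
          have e2 : lo ≤ (B y0).toReal / (b y0).toReal := (le_div_iff₀ hp0).2 (h3 y0).1
          linarith
      calc B y = B y / b y * b y := (ENNReal.div_mul_cancel h0 (hb y)).symm
        _ ≤ _ := by gcongr

end Pointwise

section Smoothing

variable {q : 𝓧 × 𝓨 → 𝓧 × 𝓨 → ℝ≥0∞} {κ : Kernel (𝓧 × 𝓨) (𝓧 × 𝓨)} {μ : Measure 𝓧}
  {T : Kernel (𝓧 × 𝓨) (ℕ → 𝓧 × 𝓨)} {P : Measure Ω} {Z : ℕ → Ω → 𝓧 × 𝓨}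

/-- constraint sets for `Y_{t:t+m-1} = v` -/
def Ag (T m : ℕ) (v : Fin m → 𝓨) (i : ℕ) : Set (𝓧 × 𝓨) := {z | ∀ h : Fin m, i = T + h → z.2 = v h}

theorem measurableSet_Ag (T m : ℕ) (v : Fin m → 𝓨) (i : ℕ) :
    MeasurableSet (Ag T m v i : Set (𝓧 × 𝓨)) := by
  have : (Ag T m v i : Set (𝓧 × 𝓨)) =
      ⋂ h : Fin m, ⋂ _ : i = T + h, Prod.snd ⁻¹' {v h} := by
    ext z; simp [Ag]
  rw [this]
  exact MeasurableSet.iInter fun h => MeasurableSet.iInter fun _ =>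
    measurable_snd (measurableSet_singleton _)

theorem Ag_univ (T m : ℕ) (v : Fin m → 𝓨) (i : ℕ) (hi : i < T) :
    (Ag T m v i : Set (𝓧 × 𝓨)) = Set.univ := by
  ext z; simp only [Ag, Set.mem_ofPred_eq, Set.mem_univ, iff_true]
  intro h hh; omega

theorem Ag_event (T m N : ℕ) (hTN : T ≤ N) (v : Fin m → 𝓨) :
    {η : ℕ → 𝓧 × 𝓨 | ∀ i < N + m, η i ∈ Ag T m v i} = {η | ∀ h : Fin m, (η (T + h)).2 = v h} := by
  ext η
  simp only [Ag, Set.mem_ofPred_eq]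
  constructor
  · intro h j; exact h (T + j) (by omega) j rfl
  · rintro h i _ j rfl; exact h j

theorem smooth_joint [IsMarkovKernel T] [SigmaFinite μ] [IsProbabilityMeasure P]
    (hM : IsMarkovChain P Z κ)
    (hT : IsPathK κ T) (hmc : ∀ z, IsMarkovChain (T z) (fun i (η : ℕ → 𝓧 × 𝓨) => η i) κ)
    (hst : ∀ z, ∀ᵐ η ∂(T z), η 0 = z) (hq : Measurable (Function.uncurry q))
    (hκ : ∀ z, (κ z : Measure (𝓧 × 𝓨)) = (μ.prod Measure.count).withDensity (fun z' => q z' z))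
    (s T' N m : ℕ) (hTN : T' ≤ N) (V : Finset (Fin m → 𝓨))
    (H : (ℕ → 𝓧) × (Fin N → 𝓧) → ℝ≥0∞) (hH : Measurable H) :
    ∫⁻ ω, H (fun i => (Z (min i s) ω).1, fun i => (Z (s + (i + 1)) ω).1) *
        (∑ v ∈ V, {ω | ∀ i : Fin m, (Z (s + T' + i) ω).2 = v i}.indicator 1 ω) ∂P =
      ∫⁻ ω, ∫⁻ x, H (fun i => (Z (min i s) ω).1, x) *
        SB q κ m N (Ag T' m) V (exf (Fin.cons (Z s ω).1 x : Fin (N + 1) → 𝓧)) 0 (Z s ω).2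
        ∂(Measure.pi fun _ : Fin N => μ) ∂P := by
  have hU : Measurable[⨆ i ∈ Set.Iic s, MeasurableSpace.comap (Z i) inferInstance]
      (fun ω => (fun i : ℕ => (Z (min i s) ω).1)) := by
    refine @measurable_pi_lambda _ _ _ (_) _ _ fun i => ?_
    have h1 : Measurable[⨆ i ∈ Set.Iic s, MeasurableSpace.comap (Z i) inferInstance]
        (Z (min i s)) := by
      intro B hB
      exact (le_iSup₂ (f := fun i (_ : i ∈ Set.Iic s) =>
        MeasurableSpace.comap (Z i) inferInstance) (min i s) (min_le_right i s)) _ ⟨B, hB, rfl⟩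
    exact measurable_fst.comp h1
  have hev : ∀ v : Fin m → 𝓨, MeasurableSet {η : ℕ → 𝓧 × 𝓨 | ∀ h : Fin m, (η (T' + h)).2 = v h} := by
    intro v
    have : {η : ℕ → 𝓧 × 𝓨 | ∀ h : Fin m, (η (T' + h)).2 = v h} =
        ⋂ h : Fin m, (fun η : ℕ → 𝓧 × 𝓨 => (η (T' + h)).2) ⁻¹' {v h} := by ext; simp
    rw [this]
    exact MeasurableSet.iInter fun h => (measurable_snd.comp
      (measurable_pi_apply (X := fun _ : ℕ => 𝓧 × 𝓨) _)) (measurableSet_singleton _)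
  have hx : Measurable (fun η : ℕ → 𝓧 × 𝓨 => (fun i : Fin N => (η (i + 1)).1)) :=
    measurable_pi_lambda _ fun i => measurable_fst.comp
      (measurable_pi_apply (X := fun _ : ℕ => 𝓧 × 𝓨) _)
  have hHF : Measurable (fun p : (ℕ → 𝓧) × (ℕ → 𝓧 × 𝓨) =>
      H (p.1, fun i => (p.2 (i + 1)).1)) :=
    hH.comp (measurable_fst.prodMk (hx.comp measurable_snd))
  have hind : ∀ v : Fin m → 𝓨, Measurable (fun p : (ℕ → 𝓧) × (ℕ → 𝓧 × 𝓨) =>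
      {η : ℕ → 𝓧 × 𝓨 | ∀ h : Fin m, (η (T' + h)).2 = v h}.indicator (1 : (ℕ → 𝓧 × 𝓨) → ℝ≥0∞) p.2) := fun v =>
    (measurable_one.indicator (hev v)).comp measurable_snd
  have key := mc_joint hM hT s (fun ω => (fun i : ℕ => (Z (min i s) ω).1)) hU
    (fun p => H (p.1, fun i => (p.2 (i + 1)).1) *
      ∑ v ∈ V, {η : ℕ → 𝓧 × 𝓨 | ∀ h : Fin m, (η (T' + h)).2 = v h}.indicator 1 p.2)
    (hHF.mul (Finset.measurable_sum _ fun v _ => hind v))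
  have hl : ∀ ω, ∀ v : Fin m → 𝓨,
      {ω | ∀ i : Fin m, (Z (s + T' + i) ω).2 = v i}.indicator (1 : Ω → ℝ≥0∞) ω =
      {η : ℕ → 𝓧 × 𝓨 | ∀ h : Fin m, (η (T' + h)).2 = v h}.indicator (1 : (ℕ → 𝓧 × 𝓨) → ℝ≥0∞)
        (fun i => Z (s + i) ω) := by
    intro ω v
    simp only [Set.indicator_apply, Set.mem_ofPred_eq, add_assoc]
    rfl
  simp_rw [hl]
  refine key.trans ?_
  refine lintegral_congr fun ω => ?_
  simp only [Finset.mul_sum, SB]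
  have hHu : Measurable (fun x : Fin N → 𝓧 => H (fun i => (Z (min i s) ω).1, x)) :=
    hH.comp measurable_prodMk_left
  rw [lintegral_finsetSum, lintegral_finsetSum]
  · refine Finset.sum_congr rfl fun v _ => ?_
    have := density hT hmc hst hq hκ m N (Ag T' m v) (measurableSet_Ag T' m v)
      (fun x : Fin N → 𝓧 => H (fun i => (Z (min i s) ω).1, x)) hHu (Z s ω)
    rw [Ag_event T' m N hTN v] at this
    simpa using this
  · intro v _
    refine hHu.mul ?_
    have h1 := measurable_Bf (κ := κ) hq m (N - 0) (fun j => Ag T' m v (j + 0))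
      (fun i => measurableSet_Ag T' m v _) (Z s ω).2
    exact h1.comp (measurable_exf.comp (measurable_cons measurable_const measurable_id))
  · intro v _
    exact (hHu.comp hx).mul (measurable_one.indicator (hev v))

end Smoothing

section Smoothing2

variable {q : 𝓧 × 𝓨 → 𝓧 × 𝓨 → ℝ≥0∞} {κ : Kernel (𝓧 × 𝓨) (𝓧 × 𝓨)} {μ : Measure 𝓧}
  {T : Kernel (𝓧 × 𝓨) (ℕ → 𝓧 × 𝓨)} {P : Measure Ω} {Z : ℕ → Ω → 𝓧 × 𝓨}

theorem obsSigma_le (hZ : ∀ k, Measurable (Z k)) (l n : ℕ) :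
    obsSigma Z l n ≤ (inferInstance : MeasurableSpace Ω) :=
  iSup₂_le fun i _ => (measurable_fst.comp (hZ i)).comap_le

theorem obsSigma_mono {l s n : ℕ} (h : l ≤ s) : obsSigma Z s n ≤ obsSigma Z l n := by
  refine iSup₂_le fun i hi => ?_
  exact le_iSup₂ (f := fun i (_ : i ∈ Set.Icc l n) =>
    MeasurableSpace.comap (fun ω => (Z i ω).1) inferInstance) i ⟨h.trans hi.1, hi.2⟩

theorem measurable_obs (l n i : ℕ) (h1 : l ≤ i) (h2 : i ≤ n) :
    Measurable[obsSigma Z l n] (fun ω => (Z i ω).1) := by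
  intro B hB
  exact (le_iSup₂ (f := fun i (_ : i ∈ Set.Icc l n) =>
    MeasurableSpace.comap (fun ω => (Z i ω).1) inferInstance) i ⟨h1, h2⟩) _ ⟨B, hB, rfl⟩

theorem measurable_obsFrom (s i : ℕ) (h1 : s ≤ i) :
    Measurable[obsSigmaFrom Z s] (fun ω => (Z i ω).1) := by
  intro B hB
  exact (le_iSup₂ (f := fun i (_ : i ∈ Set.Ici s) =>
    MeasurableSpace.comap (fun ω => (Z i ω).1) inferInstance) i h1) _ ⟨B, hB, rfl⟩

theorem measurable_xw (s N : ℕ) :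
    Measurable[obsSigma Z s (s + N)] (fun ω => (fun i : Fin (N + 1) => (Z (s + i) ω).1)) := by
  refine @measurable_pi_lambda _ _ _ (_) _ _ fun i => ?_
  exact measurable_obs s (s + N) (s + i) (by omega) (by omega)

theorem obsSigma_comap (l s N : ℕ) : obsSigma Z l (s + N) ≤
    MeasurableSpace.comap (fun ω => ((fun i => (Z (min i s) ω).1, fun i => (Z (s + (i + 1)) ω).1) :
      (ℕ → 𝓧) × (Fin N → 𝓧))) inferInstance := by
  refine iSup₂_le fun i hi => ?_
  rintro _ ⟨B, hB, rfl⟩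
  by_cases h : i ≤ s
  · refine ⟨(fun p : (ℕ → 𝓧) × (Fin N → 𝓧) => p.1 i) ⁻¹' B,
      ((measurable_pi_apply (X := fun _ : ℕ => 𝓧) i).comp measurable_fst) hB, ?_⟩
    ext ω
    simp [min_eq_left h]
  · have hi2 := hi.2
    refine ⟨(fun p : (ℕ → 𝓧) × (Fin N → 𝓧) => p.2 ⟨i - s - 1, by omega⟩) ⁻¹' B,
      ((measurable_pi_apply (X := fun _ : Fin N => 𝓧) _).comp measurable_snd) hB, ?_⟩
    ext ω
    have : s + (i - s - 1 + 1) = i := by omega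
    simp [this]

theorem measurableSet_Ev (hZ : ∀ k, Measurable (Z k)) (t m : ℕ) (v : Fin m → 𝓨) :
    MeasurableSet {ω | ∀ i : Fin m, (Z (t + i) ω).2 = v i} := by
  have : {ω | ∀ i : Fin m, (Z (t + i) ω).2 = v i} =
      ⋂ i : Fin m, (fun ω => (Z (t + i) ω).2) ⁻¹' {v i} := by ext; simp
  rw [this]
  exact MeasurableSet.iInter fun i =>
    (measurable_snd.comp (hZ (t + i))) (measurableSet_singleton _)

/-- number of matches -/
noncomputable def FV (Z : ℕ → Ω → 𝓧 × 𝓨) (t m : ℕ) (V : Finset (Fin m → 𝓨)) (ω : Ω) : ℝ≥0∞ :=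
  ∑ v ∈ V, {ω | ∀ i : Fin m, (Z (t + i) ω).2 = v i}.indicator 1 ω

theorem FV_univ (t m : ℕ) (ω : Ω) : FV Z t m Finset.univ ω = 1 := by
  unfold FV
  rw [Finset.sum_eq_single (fun i : Fin m => (Z (t + i) ω).2)]
  · simp
  · intro v _ hv
    apply Set.indicator_of_notMem
    intro h
    exact hv (funext fun i => (h i).symm)
  · simp

theorem FV_le (t m : ℕ) (V : Finset (Fin m → 𝓨)) (ω : Ω) : FV Z t m V ω ≤ 1 := by
  rw [← FV_univ (Z := Z) t m ω]
  exact Finset.sum_le_sum_of_subset (Finset.subset_univ _)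

theorem smooth_sets [IsMarkovKernel T] [SigmaFinite μ] [IsProbabilityMeasure P]
    (hM : IsMarkovChain P Z κ)
    (hT : IsPathK κ T) (hmc : ∀ z, IsMarkovChain (T z) (fun i (η : ℕ → 𝓧 × 𝓨) => η i) κ)
    (hst : ∀ z, ∀ᵐ η ∂(T z), η 0 = z) (hq : Measurable (Function.uncurry q))
    (hκ : ∀ z, (κ z : Measure (𝓧 × 𝓨)) = (μ.prod Measure.count).withDensity (fun z' => q z' z))
    (s T' N m : ℕ) (hTN : T' ≤ N) (V1 V2 : Finset (Fin m → 𝓨))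
    (g1 g2 : (Fin (N + 1) → 𝓧) → ℝ≥0∞) (hg1 : Measurable g1) (hg2 : Measurable g2)
    (hle : ∀ w y, g1 w * SB q κ m N (Ag T' m) V1 (exf w) 0 y ≤
      g2 w * SB q κ m N (Ag T' m) V2 (exf w) 0 y) (l : ℕ) (C : Set Ω)
    (hC : MeasurableSet[obsSigma Z l (s + N)] C) :
    ∫⁻ ω in C, g1 (fun i : Fin (N + 1) => (Z (s + i) ω).1) * FV Z (s + T') m V1 ω ∂P ≤
      ∫⁻ ω in C, g2 (fun i : Fin (N + 1) => (Z (s + i) ω).1) * FV Z (s + T') m V2 ω ∂P := by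
  have hC0 : MeasurableSet C := obsSigma_le hM.1 _ _ _ hC
  obtain ⟨C', hC', rfl⟩ := obsSigma_comap l s N _ hC
  have hcons : ∀ ω, (fun i : Fin (N + 1) => (Z (s + i) ω).1) =
      (Fin.cons (Z (min s s) ω).1 (fun i : Fin N => (Z (s + (i + 1)) ω).1) : Fin (N + 1) → 𝓧) := by
    intro ω
    ext i
    refine Fin.cases ?_ (fun j => ?_) i
    · simp
    · simp
  have hm : Measurable (fun p : (ℕ → 𝓧) × (Fin N → 𝓧) =>
      (Fin.cons (p.1 s) p.2 : Fin (N + 1) → 𝓧)) :=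
    measurable_cons ((measurable_pi_apply (X := fun _ : ℕ => 𝓧) s).comp measurable_fst)
      measurable_snd
  have main : ∀ (g : (Fin (N + 1) → 𝓧) → ℝ≥0∞), Measurable g → ∀ V : Finset (Fin m → 𝓨),
      ∫⁻ ω in (fun ω => ((fun i => (Z (min i s) ω).1, fun i => (Z (s + (i + 1)) ω).1) :
      (ℕ → 𝓧) × (Fin N → 𝓧))) ⁻¹' C',
        g (fun i : Fin (N + 1) => (Z (s + i) ω).1) * FV Z (s + T') m V ω ∂P =
      ∫⁻ ω, ∫⁻ x, C'.indicator 1 ((fun i => (Z (min i s) ω).1, x) : (ℕ → 𝓧) × (Fin N → 𝓧)) *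
        (g (Fin.cons (Z (min s s) ω).1 x : Fin (N + 1) → 𝓧) *
        SB q κ m N (Ag T' m) V (exf (Fin.cons (Z (min s s) ω).1 x : Fin (N + 1) → 𝓧)) 0 (Z s ω).2)
        ∂(Measure.pi fun _ : Fin N => μ) ∂P := by
    intro g hg V
    have := smooth_joint hM hT hmc hst hq hκ s T' N m hTN V
      (fun p => C'.indicator 1 p * g (Fin.cons (p.1 s) p.2 : Fin (N + 1) → 𝓧))
      ((measurable_one.indicator hC').mul (hg.comp hm))
    rw [← lintegral_indicator hC0]
    simp only [mul_assoc] at this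
    rw [min_self] at this
    simp only [min_self]
    rw [← this]
    refine lintegral_congr fun ω => ?_
    have hcc := hcons ω
    rw [min_self] at hcc
    rw [← hcc]
    by_cases hin : ((fun i => (Z (min i s) ω).1, fun i => (Z (s + (i + 1)) ω).1) :
      (ℕ → 𝓧) × (Fin N → 𝓧)) ∈ C'
    · rw [Set.indicator_of_mem (by exact hin), Set.indicator_of_mem hin]
      simp [FV]
    · rw [Set.indicator_of_notMem (by exact hin), Set.indicator_of_notMem hin]
      simp
  rw [main g1 hg1 V1, main g2 hg2 V2]
  refine lintegral_mono fun ω => lintegral_mono fun x => ?_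
  exact mul_le_mul_right (hle _ _) _

theorem ae_le_of_sets {Ω' : Type*} {m0 mΩ : MeasurableSpace Ω'} {P : Measure Ω'} (hm : m0 ≤ mΩ)
    [IsProbabilityMeasure P] {a b : Ω' → ℝ} (ha : StronglyMeasurable[m0] a)
    (hb : StronglyMeasurable[m0] b) (hai : Integrable a P) (hbi : Integrable b P)
    (h : ∀ C, MeasurableSet[m0] C → ∫ ω in C, a ω ∂P ≤ ∫ ω in C, b ω ∂P) : a ≤ᵐ[P] b := by
  apply ae_le_of_ae_le_trim (hm := hm)
  refine ae_le_of_forall_setIntegral_le (hai.trim hm ha) (hbi.trim hm hb) fun C hC _ => ?_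
  rw [← setIntegral_trim hm ha hC, ← setIntegral_trim hm hb hC]
  exact h C hC

theorem setInt_le {C : Set Ω} [IsProbabilityMeasure P] {a b : Ω → ℝ≥0∞} (ha : Measurable a)
    (hb : Measurable b) (ha2 : ∀ ω, a ω ≤ 2) (hb2 : ∀ ω, b ω ≤ 2)
    (h : ∫⁻ ω in C, a ω ∂P ≤ ∫⁻ ω in C, b ω ∂P) :
    ∫ ω in C, (a ω).toReal ∂P ≤ ∫ ω in C, (b ω).toReal ∂P := by
  have h2 : (2 : ℝ≥0∞) < ∞ := by simp
  rw [integral_toReal ha.aemeasurable (Filter.Eventually.of_forall fun ω => (ha2 ω).trans_lt h2),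
    integral_toReal hb.aemeasurable (Filter.Eventually.of_forall fun ω => (hb2 ω).trans_lt h2)]
  refine ENNReal.toReal_mono ?_ h
  refine ne_top_of_le_ne_top ?_ (lintegral_mono hb2)
  rw [lintegral_const]
  exact ENNReal.mul_ne_top (by simp) (measure_ne_top _ _)

theorem integrable_toReal' [IsProbabilityMeasure P] {a : Ω → ℝ≥0∞} (ha : Measurable a)
    (ha2 : ∀ ω, a ω ≤ 2) : Integrable (fun ω => (a ω).toReal) P := by
  refine Integrable.of_bound ha.ennreal_toReal.aestronglyMeasurable 2
    (Filter.Eventually.of_forall fun ω => ?_)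
  rw [Real.norm_of_nonneg ENNReal.toReal_nonneg]
  simpa using ENNReal.toReal_mono (by simp) (ha2 ω)

theorem cond_sandwich {Ω' : Type*} {m0 mΩ : MeasurableSpace Ω'} {P : Measure Ω'} [IsProbabilityMeasure P]
    (hm : m0 ≤ mΩ) {a b f : Ω' → ℝ≥0∞}
    (ha : Measurable[m0] a) (hb : Measurable[m0] b) (hf : Measurable f) (ha2 : ∀ ω, a ω ≤ 2)
    (hb2 : ∀ ω, b ω ≤ 2) (hf2 : ∀ ω, f ω ≤ 2)
    (h1 : ∀ C, MeasurableSet[m0] C → ∫⁻ ω in C, a ω ∂P ≤ ∫⁻ ω in C, f ω ∂P)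
    (h2 : ∀ C, MeasurableSet[m0] C → ∫⁻ ω in C, f ω ∂P ≤ ∫⁻ ω in C, b ω ∂P) :
    ∀ᵐ ω ∂P, (a ω).toReal ≤ (P[fun ω => (f ω).toReal | m0]) ω ∧
      (P[fun ω => (f ω).toReal | m0]) ω ≤ (b ω).toReal := by
  have ha0 : Measurable a := ha.mono hm le_rfl
  have hb0 : Measurable b := hb.mono hm le_rfl
  have e1 : (fun ω => (a ω).toReal) ≤ᵐ[P] P[fun ω => (f ω).toReal | m0] := by
    refine ae_le_of_sets hm (ha.ennreal_toReal).stronglyMeasurable stronglyMeasurable_condExp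
      (integrable_toReal' ha0 ha2) integrable_condExp fun C hC => ?_
    rw [setIntegral_condExp hm (integrable_toReal' hf hf2) hC]
    exact setInt_le ha0 hf ha2 hf2 (h1 C hC)
  have e2 : P[fun ω => (f ω).toReal | m0] ≤ᵐ[P] (fun ω => (b ω).toReal) := by
    refine ae_le_of_sets hm stronglyMeasurable_condExp (hb.ennreal_toReal).stronglyMeasurable integrable_condExp
      (integrable_toReal' hb0 hb2) fun C hC => ?_
    rw [setIntegral_condExp hm (integrable_toReal' hf hf2) hC]
    exact setInt_le hf hb0 hf2 hb2 (h2 C hC)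
  filter_upwards [e1, e2] with ω h h' using ⟨h, h'⟩

end Smoothing2

section TV

variable {q : 𝓧 × 𝓨 → 𝓧 × 𝓨 → ℝ≥0∞} {κ : Kernel (𝓧 × 𝓨) (𝓧 × 𝓨)} {μ : Measure 𝓧}
  {T : Kernel (𝓧 × 𝓨) (ℕ → 𝓧 × 𝓨)} {P : Measure Ω} {Z : ℕ → Ω → 𝓧 × 𝓨}

theorem sum_abs_le {ι : Type*} [Fintype ι] (f : ι → ℝ) {d : ℝ}
    (h : ∀ V : Finset ι, |∑ v ∈ V, f v| ≤ d) : ∑ v, |f v| ≤ 2 * d := by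
  classical
  rw [← Finset.sum_filter_add_sum_filter_not Finset.univ (fun v => 0 ≤ f v)]
  have h1 : ∑ v ∈ Finset.univ.filter (fun v => 0 ≤ f v), |f v| =
      ∑ v ∈ Finset.univ.filter (fun v => 0 ≤ f v), f v :=
    Finset.sum_congr rfl fun v hv => abs_of_nonneg (Finset.mem_filter.1 hv).2
  have h2 : ∑ v ∈ Finset.univ.filter (fun v => ¬ 0 ≤ f v), |f v| =
      - ∑ v ∈ Finset.univ.filter (fun v => ¬ 0 ≤ f v), f v := by
    rw [← Finset.sum_neg_distrib]
    exact Finset.sum_congr rfl fun v hv => abs_of_neg (not_le.1 (Finset.mem_filter.1 hv).2)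
  rw [h1, h2]
  have := (abs_le.1 (h (Finset.univ.filter (fun v => 0 ≤ f v)))).2
  have := (abs_le.1 (h (Finset.univ.filter (fun v => ¬ 0 ≤ f v)))).1
  linarith

theorem smooth_sum [IsProbabilityMeasure P] (hZ : ∀ k, Measurable (Z k)) (t l n m : ℕ)
    (V : Finset (Fin m → 𝓨)) :
    ∀ᵐ ω ∂P, (P[fun ω => (FV Z t m V ω).toReal | obsSigma Z l n]) ω =
      ∑ v ∈ V, smooth P Z t l n v ω := by
  have e : (fun ω => (FV Z t m V ω).toReal) = ∑ v ∈ V,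
      {ω | ∀ i : Fin m, (Z (t + i) ω).2 = v i}.indicator (fun _ => (1 : ℝ)) := by
    ext ω
    rw [Finset.sum_apply]
    unfold FV
    rw [ENNReal.toReal_sum]
    · refine Finset.sum_congr rfl fun v _ => ?_
      by_cases h : ω ∈ {ω | ∀ i : Fin m, (Z (t + i) ω).2 = v i}
      · rw [Set.indicator_of_mem h, Set.indicator_of_mem h]; simp
      · rw [Set.indicator_of_notMem h, Set.indicator_of_notMem h]; simp
    · intro v _
      by_cases h : ω ∈ {ω | ∀ i : Fin m, (Z (t + i) ω).2 = v i}
      · rw [Set.indicator_of_mem h]; simp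
      · rw [Set.indicator_of_notMem h]; simp
  rw [e]
  have := condExp_finsetSum (μ := P) (s := V) (f := fun v =>
    {ω | ∀ i : Fin m, (Z (t + i) ω).2 = v i}.indicator (fun _ => (1 : ℝ)))
    (fun v _ => (integrable_const (1 : ℝ)).indicator (measurableSet_Ev hZ t m v)) (obsSigma Z l n)
  filter_upwards [this] with ω hω
  rw [hω, Finset.sum_apply]
  rfl

theorem tv_bound [IsMarkovKernel κ] [IsMarkovKernel T] [SigmaFinite μ] [IsProbabilityMeasure P]
    (hM : IsMarkovChain P Z κ)
    (hT : IsPathK κ T) (hmc : ∀ z, IsMarkovChain (T z) (fun i (η : ℕ → 𝓧 × 𝓨) => η i) κ)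
    (hst : ∀ z, ∀ᵐ η ∂(T z), η 0 = z) (hq : Measurable (Function.uncurry q))
    (hκ : ∀ z, (κ z : Measure (𝓧 × 𝓨)) = (μ.prod Measure.count).withDensity (fun z' => q z' z))
    (hqf : ∀ z z', q z z' ≠ ∞)
    {R : ℕ} (hR : 1 ≤ R) {F : Set (Fin (R + 1) → 𝓧)} (hFm : MeasurableSet F) {Yp : Set (𝓨 × 𝓨)}
    (hYp : Yp = (Prod.fst '' Yp) ×ˢ (Prod.snd '' Yp)) {M : ℕ}
    (hF : ∀ x ∈ F, ∀ i j, ((i, j) ∈ Yp → (M : ℝ≥0∞)⁻¹ ≤ pijD q x i j ∧ pijD q x i j ≤ M) ∧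
      ((i, j) ∉ Yp → pijD q x i j = 0)) {ρ : ℝ} (hρ : ρ = 1 - 1 / (2 * ((M : ℝ) + 1) ^ 2))
    (hρ0 : 0 < ρ) (hρ1 : ρ ≤ 1)
    (l s T' N m : ℕ) (hls : l ≤ s) (hTN : T' ≤ N) :
    ∀ᵐ ω ∂P, tvBlock P Z (s + T') l s (s + N) m ω ≤
      2 * ρ ^ (gcount F (T' + 1 - R) (fun i => (Z (s + i) ω).1) / R) := by
  have hm1 : Measurable fun w : Fin (N + 1) → 𝓧 =>
      ENNReal.ofReal (ρ ^ (gcount F (T' + 1 - R) (exf w) / R)) := by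
    have : Measurable fun w : Fin (N + 1) → 𝓧 => gcount F (T' + 1 - R) (exf w) / R :=
      ((measurable_gcount hFm _).comp measurable_exf).div_const _
    exact (Measurable.pow measurable_const this).ennreal_ofReal
  have hSB : ∀ (V : Finset (Fin m → 𝓨)) (y : 𝓨), Measurable fun w : Fin (N + 1) → 𝓧 =>
      SB q κ m N (Ag T' m) V (exf w) 0 y := by
    intro V y
    unfold SB
    refine Finset.measurable_sum _ fun v _ => ?_
    have h1 := measurable_Bf (κ := κ) hq m (N - 0) (fun j => Ag T' m v (j + 0))
      (fun i => measurableSet_Ag T' m v _) y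
    exact h1.comp measurable_exf
  have hlo : ∀ V : Finset (Fin m → 𝓨), Measurable fun w : Fin (N + 1) → 𝓧 =>
      loE (SB q κ m N (Ag T' m) V (exf w) 0) (SB q κ m N (Ag T' m) Finset.univ (exf w) 0) :=
    fun V => measurable_loE (fun y => hSB V y) (fun y => hSB Finset.univ y)
  have hspec : ∀ (V : Finset (Fin m → 𝓨)) (w : Fin (N + 1) → 𝓧), _ := fun V w =>
    loE_spec (SB q κ m N (Ag T' m) V (exf w) 0) (SB q κ m N (Ag T' m) Finset.univ (exf w) 0)
      (fun y => Finset.sum_le_sum_of_subset (Finset.subset_univ _))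
      (fun y => SB_ne_top hqf _ _ _ _ _ _ _)
      (SB_osc hqf hR hYp hF hρ m N T' hTN (Ag T' m) (fun v k hk => Ag_univ T' m v k hk) V (exf w))
  have hgc0 : ∀ x : ℕ → 𝓧, 0 ≤ gcount F (T' + 1 - R) x := fun x =>
    Finset.sum_nonneg fun k _ => Set.indicator_nonneg (fun _ _ => zero_le_one) _
  have hD1 : ∀ x : ℕ → 𝓧, ENNReal.ofReal (ρ ^ (gcount F (T' + 1 - R) x / R)) ≤ 1 := by
    intro x
    rw [ENNReal.ofReal_le_one]
    exact Real.rpow_le_one hρ0.le hρ1 (div_nonneg (hgc0 x) (Nat.cast_nonneg _))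
  have hFVm : ∀ V : Finset (Fin m → 𝓨), Measurable (FV Z (s + T') m V) := fun V =>
    Finset.measurable_sum _ fun v _ => measurable_one.indicator (measurableSet_Ev hM.1 _ m v)
  have sand : ∀ (V : Finset (Fin m → 𝓨)) (l : ℕ), l ≤ s → ∀ᵐ ω ∂P, _ := fun V l hl =>
    cond_sandwich (P := P) (obsSigma_le hM.1 l (s + N))
      (a := fun ω => (fun w : Fin (N + 1) → 𝓧 =>
        loE (SB q κ m N (Ag T' m) V (exf w) 0) (SB q κ m N (Ag T' m) Finset.univ (exf w) 0))
        (fun i : Fin (N + 1) => (Z (s + i) ω).1))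
      (b := fun ω => (fun w : Fin (N + 1) → 𝓧 =>
        loE (SB q κ m N (Ag T' m) V (exf w) 0) (SB q κ m N (Ag T' m) Finset.univ (exf w) 0) +
        ENNReal.ofReal (ρ ^ (gcount F (T' + 1 - R) (exf w) / R)))
        (fun i : Fin (N + 1) => (Z (s + i) ω).1))
      (f := FV Z (s + T') m V)
      ((hlo V).comp ((measurable_xw s N).mono (obsSigma_mono hl) le_rfl))
      (((hlo V).add hm1).comp ((measurable_xw s N).mono (obsSigma_mono hl) le_rfl))
      (hFVm V)
      (fun ω => (hspec V _).1.trans one_le_two)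
      (fun ω => (add_le_add (hspec V _).1 (hD1 _)).trans one_add_one_eq_two.le)
      (fun ω => (FV_le _ _ _ _).trans one_le_two)
      (fun C hC => by
        have := smooth_sets hM hT hmc hst hq hκ s T' N m hTN Finset.univ V _ (fun _ => 1) (hlo V)
          measurable_const (fun w y => by rw [one_mul]; exact ((hspec V w).2 y).1) l C hC
        simpa only [FV_univ, mul_one, one_mul] using this)
      (fun C hC => by
        have := smooth_sets hM hT hmc hst hq hκ s T' N m hTN V Finset.univ (fun _ => 1) _
          measurable_const ((hlo V).add hm1)
          (fun w y => by rw [one_mul]; exact ((hspec V w).2 y).2) l C hC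
        simpa only [Pi.add_apply, FV_univ, mul_one, one_mul] using this)
  have hall : ∀ᵐ ω ∂P, ∀ V : Finset (Fin m → 𝓨),
      |∑ v ∈ V, (smooth P Z (s + T') l (s + N) v ω - smooth P Z (s + T') s (s + N) v ω)| ≤
        ρ ^ (gcount F (T' + 1 - R) (fun i => (Z (s + i) ω).1) / R) := by
    rw [ae_all_iff]
    intro V
    filter_upwards [sand V l hls, sand V s le_rfl, smooth_sum hM.1 (s + T') l (s + N) m V,
      smooth_sum hM.1 (s + T') s (s + N) m V] with ω h1 h2 h3 h4
    rw [h3] at h1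
    rw [h4] at h2
    have hx : gcount F (T' + 1 - R) (exf (fun i : Fin (N + 1) => (Z (s + i) ω).1)) =
        gcount F (T' + 1 - R) (fun i => (Z (s + i) ω).1) :=
      gcount_congr F T' _ _ fun i hi => by rw [exf_apply _ i (hi.trans hTN)]
    have hne : loE (SB q κ m N (Ag T' m) V (exf (fun i : Fin (N + 1) => (Z (s + i) ω).1)) 0)
        (SB q κ m N (Ag T' m) Finset.univ (exf (fun i : Fin (N + 1) => (Z (s + i) ω).1)) 0) ≠ ∞ :=
      ne_top_of_le_ne_top ENNReal.one_ne_top (hspec V _).1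
    simp only [ENNReal.toReal_add hne ENNReal.ofReal_ne_top,
      ENNReal.toReal_ofReal (Real.rpow_nonneg hρ0.le _), hx] at h1 h2
    rw [Finset.sum_sub_distrib, abs_le]
    constructor <;> linarith [h1.1, h1.2, h2.1, h2.2]
  filter_upwards [hall] with ω hω
  exact sum_abs_le _ hω

end TV

/-- Theorem 1 (ii). If the PMM `Z` satisfies **A1**, **A2** and is positive
Harris, then there is `α ∈ (0,1)` such that for every `s` there is a
`σ(X_{s:∞})`-measurable (finite, real-valued) random variable `C_s` with, for all
`t ≥ s ≥ l`, almost surely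
`sup_{n ≥ t} sup_{m ≥ 1} ‖ν^t_{l:n;m} − ν^t_{s:n;m}‖_TV ≤ C_s α^{t−s}`. -/
theorem exponential_forgetting_of_smoothing
    [TopologicalSpace 𝓧] [PolishSpace 𝓧] [BorelSpace 𝓧]
    (P : Measure Ω) (Z : ℕ → Ω → 𝓧 × 𝓨) (κ : Kernel (𝓧 × 𝓨) (𝓧 × 𝓨)) (μ : Measure 𝓧)
    (q : 𝓧 × 𝓨 → 𝓧 × 𝓨 → ℝ≥0∞) (p0 : 𝓧 × 𝓨 → ℝ≥0∞)
    (Pz : 𝓧 × 𝓨 → Measure (ℕ → 𝓧 × 𝓨)) (ψ : Measure (𝓧 × 𝓨))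
    {R : ℕ} (E : Set (Fin (R + 1) → 𝓧)) (Yp : Set (𝓨 × 𝓨))
    (hPMM : IsPMM P Z κ μ q p0)
    (hA1 : Assumption1 q E Yp) (hA2 : Assumption2 κ ψ μ E Yp)
    (hFam : IsMarkovFamily κ Pz) (hHarris : HarrisProp κ Pz ψ)
    (hPos : IsPositive κ) :
    ∃ α : ℝ, 0 < α ∧ α < 1 ∧ ∀ s : ℕ, ∃ C : Ω → ℝ,
      Measurable[obsSigmaFrom Z s] C ∧
      ∀ l t : ℕ, l ≤ s → s ≤ t → ∀ᵐ ω ∂P, ∀ n, t ≤ n → ∀ m, 1 ≤ m →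
        tvBlock P Z t l s n m ω ≤ C ω * α ^ (t - s) := by
  obtain ⟨hP, hM, hμ, hq, _, hκ, _⟩ := hPMM
  obtain ⟨π, hπp, hπ⟩ := hPos
  have hκM : IsMarkovKernel κ := family_markov hFam
  obtain ⟨T, hTM, hT, hTz⟩ := exists_pathK hFam
  have hmc : ∀ z, IsMarkovChain (T z) (fun i (η : ℕ → 𝓧 × 𝓨) => η i) κ := fun z => by
    rw [hTz z]; exact family_mc hFam z
  have hst : ∀ z, ∀ᵐ η ∂(T z), η 0 = z := fun z => by
    rw [hTz z]; exact family_start hFam z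
  have hH : HarrisProp κ (fun z => T z) ψ := by
    have : (fun z => T z) = Pz := funext hTz
    rw [this]; exact hHarris
  have hψ : 0 < ψ Set.univ := hA2.2.1.trans_le (measure_mono (Set.subset_univ _))
  obtain ⟨q', hq', hqf, hκ', F, M, hFm, hF, hpos⟩ := good_blocks hT hmc hst hq hκ hπ hA1 hA2
  have hblk : Measurable (fun η : ℕ → 𝓧 × 𝓨 => (fun k : Fin (R + 1) => (η k).1)) :=
    measurable_pi_lambda _ fun k => measurable_fst.comp
      (measurable_pi_apply (X := fun _ : ℕ => 𝓧 × 𝓨) _)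
  have hG : MeasurableSet {η : ℕ → 𝓧 × 𝓨 | (fun k : Fin (R + 1) => (η k).1) ∈ F} := hblk hFm
  obtain ⟨c, hc, hfreq⟩ := frequency hT hmc hst hψ hH hπ hG hpos
  have hR : 1 ≤ R := hA1.1
  have hR' : (0 : ℝ) < R := by exact_mod_cast hR
  obtain ⟨ρ, hρ⟩ : ∃ ρ : ℝ, ρ = 1 - 1 / (2 * ((M : ℝ) + 1) ^ 2) := ⟨_, rfl⟩
  have hδ1 : 1 / (2 * ((M : ℝ) + 1) ^ 2) ≤ 1 / 2 := by
    apply one_div_le_one_div_of_le (by norm_num)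
    have hM0 : (0 : ℝ) ≤ M := Nat.cast_nonneg M
    nlinarith
  have hδ0 : 0 < 1 / (2 * ((M : ℝ) + 1) ^ 2) := by positivity
  have hρ0 : 0 < ρ := by linarith
  have hρ1 : ρ < 1 := by linarith
  have hα0 : 0 < ρ ^ (c / R) := Real.rpow_pos_of_pos hρ0 _
  refine ⟨ρ ^ (c / R), hα0, Real.rpow_lt_one hρ0.le hρ1 (div_pos hc hR'), fun s => ?_⟩
  set W : (ℕ → 𝓧) → ℝ≥0∞ := fun x => ⨆ n : ℕ,
    ENNReal.ofReal (2 * ρ ^ (gcount F (n + 1 - R) x / R) / (ρ ^ (c / R)) ^ n) with hW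
  have hWm : Measurable W := by
    refine Measurable.iSup fun n => Measurable.ennreal_ofReal ?_
    have h1 : Measurable fun x : ℕ → 𝓧 => gcount F (n + 1 - R) x / R :=
      (measurable_gcount hFm _).div_const _
    exact ((Measurable.pow measurable_const h1).const_mul 2).div_const _
  have hpath : Measurable[obsSigmaFrom Z s] (fun ω => (fun i : ℕ => (Z (s + i) ω).1)) := by
    refine @measurable_pi_lambda _ _ _ (_) _ _ fun i => ?_
    exact measurable_obsFrom s (s + i) (by omega)
  refine ⟨fun ω => (W (fun i : ℕ => (Z (s + i) ω).1)).toReal,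
    hWm.ennreal_toReal.comp hpath, fun l t hls hst' => ?_⟩
  -- almost sure lower bound for the number of good blocks
  have hBm : MeasurableSet {η : ℕ → 𝓧 × 𝓨 | ∃ K : ℕ, ∀ n : ℕ, c * n - K ≤
      ∑ k ∈ Finset.range n, {η : ℕ → 𝓧 × 𝓨 | (fun k : Fin (R + 1) => (η k).1) ∈ F}.indicator
        (fun _ => (1 : ℝ)) (fun i => η (k + i))} := by
    have hsm : ∀ n : ℕ, Measurable fun η : ℕ → 𝓧 × 𝓨 => ∑ k ∈ Finset.range n,
        {η : ℕ → 𝓧 × 𝓨 | (fun k : Fin (R + 1) => (η k).1) ∈ F}.indicator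
        (fun _ => (1 : ℝ)) (fun i => η (k + i)) := by
      intro n
      refine Finset.measurable_sum _ fun k _ => ?_
      exact (measurable_const.indicator hG).comp
        (measurable_pi_lambda _ fun i => measurable_pi_apply (X := fun _ : ℕ => 𝓧 × 𝓨) _)
    simp only [Set.setOf_exists, Set.setOf_forall]
    exact MeasurableSet.iUnion fun K => MeasurableSet.iInter fun n =>
      measurableSet_le measurable_const (hsm n)
  have hfr : ∀ᵐ ω ∂P, ∃ K : ℕ, ∀ n : ℕ,
      c * n - K ≤ gcount F n (fun i : ℕ => (Z (s + i) ω).1) := by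
    have h0 := mc_set hM hT s (C := Set.univ) MeasurableSet.univ hBm.compl
    rw [lintegral_congr (g := fun _ => 0) (fun ω => hfreq (Z s ω)), lintegral_zero,
      Set.univ_inter] at h0
    have h1 : ∀ᵐ ω ∂P, (fun i => Z (s + i) ω) ∈ {η : ℕ → 𝓧 × 𝓨 | ∃ K : ℕ, ∀ n : ℕ, c * n - K ≤
      ∑ k ∈ Finset.range n, {η : ℕ → 𝓧 × 𝓨 | (fun k : Fin (R + 1) => (η k).1) ∈ F}.indicator
        (fun _ => (1 : ℝ)) (fun i => η (k + i))} := h0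
    filter_upwards [h1] with ω hω
    exact hω
  have htv : ∀ᵐ ω ∂P, ∀ N m : ℕ, t - s ≤ N → tvBlock P Z (s + (t - s)) l s (s + N) m ω ≤
      2 * ρ ^ (gcount F ((t - s) + 1 - R) (fun i => (Z (s + i) ω).1) / R) := by
    rw [ae_all_iff]; intro N
    rw [ae_all_iff]; intro m
    by_cases hN : t - s ≤ N
    · filter_upwards [tv_bound hM hT hmc hst hq' hκ' hqf hR hFm hA1.2.2.2 hF hρ hρ0 hρ1.le
        l s (t - s) N m hls hN] with ω hω _ using hω
    · exact Filter.Eventually.of_forall fun ω h => absurd h hN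
  filter_upwards [hfr, htv] with ω hK hω n htn m _
  obtain ⟨K, hK⟩ := hK
  have h1 := hω (n - s) m (by omega)
  rw [Nat.add_sub_cancel' hst', Nat.add_sub_cancel' (hst'.trans htn)] at h1
  refine h1.trans ?_
  set x : ℕ → 𝓧 := fun i => (Z (s + i) ω).1 with hx
  have hWfin : W x ≠ ∞ := by
    refine ne_top_of_le_ne_top (ENNReal.ofReal_ne_top (r := 2 * ρ ^ (-(c * R + K) / R)))
      (iSup_le fun j => ENNReal.ofReal_le_ofReal ?_)
    rw [div_le_iff₀ (pow_pos hα0 j), mul_assoc, ← Real.rpow_natCast, ← Real.rpow_mul hρ0.le,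
      ← Real.rpow_add hρ0]
    refine mul_le_mul_of_nonneg_left ?_ zero_le_two
    apply Real.rpow_le_rpow_of_exponent_ge hρ0 hρ1.le
    have e1 : -(c * R + K) / R + c / R * j = (c * (j - R) - K) / R := by field_simp; ring
    rw [e1]
    refine div_le_div_of_nonneg_right ?_ hR'.le
    refine le_trans ?_ (hK (j + 1 - R))
    have e2 : (j : ℝ) - R ≤ ((j + 1 - R : ℕ) : ℝ) := by
      have : j ≤ (j + 1 - R) + R := by omega
      have : (j : ℝ) ≤ ((j + 1 - R : ℕ) : ℝ) + R := by exact_mod_cast this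
      linarith
    nlinarith
  rw [← div_le_iff₀ (pow_pos hα0 _)]
  have hnn : 0 ≤ 2 * ρ ^ (gcount F ((t - s) + 1 - R) x / R) / (ρ ^ (c / R)) ^ (t - s) :=
    div_nonneg (mul_nonneg zero_le_two (Real.rpow_nonneg hρ0.le _)) (pow_pos hα0 _).le
  rw [← ENNReal.toReal_ofReal hnn]
  exact ENNReal.toReal_mono hWfin (le_iSup (fun j : ℕ =>
    ENNReal.ofReal (2 * ρ ^ (gcount F (j + 1 - R) x / R) / (ρ ^ (c / R)) ^ j)) (t - s))

end PMMPaper
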